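/- arXiv:1209.5993 — 7 statements merged into one kernel-verified Lean document; each statement's English description precedes it below -/
import Mathlib

section
/- Let K be an algebraically closed field of characteristic zero and let m, r ≥ 1. A polynomial f in the r·m² variable entries of r generic m×m matrices U₁,…,U_r is an SL_m-invariant (i.e., f(PA₁P⁻¹,…,PA_rP⁻¹) = f(A₁,…,A_r) for all P ∈ SL_m(K) and all m×m matrices A₁,…,A_r over K) if and only if f lies in the K-subalgebra of the polynomial ring generated by the trace monomials T_α(U) = trace(U_{i₁}⋯U_{i_l}) over all words α = (i₁,…,i_l) with entries in {1,…,r} of length l ≤ m². (First Fundamental Theorem of matrix invariants, Procesi–Razmyslov–Formanek.) -/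
open MvPolynomial Matrix

/-- The `i`-th generic `m × m` matrix over `K`: its `(a, b)` entry is the
variable `X (i, a, b)` of the polynomial ring in the `r·m²` matrix entries. -/
noncomputable def genericMatrix (K : Type*) [CommSemiring K] (r m : ℕ) (i : Fin r) :
    Matrix (Fin m) (Fin m) (MvPolynomial (Fin r × Fin m × Fin m) K) :=
  Matrix.of fun a b => MvPolynomial.X (i, a, b)

/-- `f` is an `SL_m`-invariant: `f(PA₁P⁻¹, …, PA_rP⁻¹) = f(A₁, …, A_r)` for every
`P ∈ SL_m(K)` and every tuple of `m × m` matrices `A₁, …, A_r` over `K`. -/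
def IsMatrixInvariant (K : Type*) [Field K] (r m : ℕ)
    (f : MvPolynomial (Fin r × Fin m × Fin m) K) : Prop :=
  ∀ (P : Matrix.SpecialLinearGroup (Fin m) K) (A : Fin r → Matrix (Fin m) (Fin m) K),
    MvPolynomial.eval
        (fun p : Fin r × Fin m × Fin m => (P.1 * A p.1 * (P⁻¹).1) p.2.1 p.2.2) f
      = MvPolynomial.eval (fun p : Fin r × Fin m × Fin m => A p.1 p.2.1 p.2.2) f

open Equiv Equiv.Perm

/-- The generalized trace `∑ₐ ∏ᵢ (xᵢ)_{a i, a (σ i)}`, the product over the cycles of `σ` of the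
traces of the products of the `xᵢ` along the cycle. -/
def permTrace {ι n R : Type*} [Fintype ι] [DecidableEq ι] [Fintype n] [CommSemiring R]
    (σ : Perm ι) (x : ι → Matrix n n R) : R :=
  ∑ a : ι → n, ∏ i, x i (a i) (a (σ i))

section PermTrace

variable {ι κ n R : Type*} [Fintype ι] [DecidableEq ι] [Fintype κ] [DecidableEq κ]
  [Fintype n] [CommSemiring R]

theorem permTrace_comp_equiv (e : ι ≃ κ) (σ : Perm κ) (x : κ → Matrix n n R) :
    permTrace ((e.trans σ).trans e.symm) (x ∘ e) = permTrace σ x := by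
  refine Fintype.sum_equiv (e.arrowCongr (Equiv.refl n)) _ _ fun a => ?_
  refine Fintype.prod_equiv e _ _ fun i => ?_
  simp [Equiv.arrowCongr]

theorem permTrace_of_isEmpty [IsEmpty ι] (σ : Perm ι) (x : ι → Matrix n n R) :
    permTrace σ x = 1 := by
  simp [permTrace]

theorem permTrace_option_of_fixed (σ : Perm (Option ι)) (x : Option ι → Matrix n n R)
    (h : σ none = none) :
    permTrace σ x = trace (x none) * permTrace (removeNone σ) (x ∘ some) := by
  have hs : ∀ i, σ (some i) = some (removeNone σ i) := fun i =>
    (removeNone_some σ (Option.ne_none_iff_exists'.1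
      fun h' => by simpa using σ.injective (h'.trans h.symm))).symm
  rw [permTrace, permTrace, Matrix.trace, Finset.sum_mul_sum, ← Finset.sum_product',
    Finset.univ_product_univ]
  refine Fintype.sum_equiv Equiv.piOptionEquivProd _ _ fun a => ?_
  simp [Fintype.prod_option, h, hs, Equiv.piOptionEquivProd]

theorem permTrace_option_of_some (σ : Perm (Option ι)) (x : Option ι → Matrix n n R) (b : ι)
    (h : σ (some b) = none) :
    permTrace σ x = permTrace (removeNone σ)
      (Function.update (x ∘ some) b (x (some b) * x none)) := by
  have hb : σ none = some (removeNone σ b) := (removeNone_none σ h).symm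
  have hs : ∀ i, i ≠ b → σ (some i) = some (removeNone σ i) := fun i hi =>
    (removeNone_some σ (Option.ne_none_iff_exists'.1
      fun h' => hi (by simpa using σ.injective (h'.trans h.symm)))).symm
  have key : ∀ a : ι → n, (∏ i, Function.update (x ∘ some) b (x (some b) * x none) i (a i)
      (a (removeNone σ i))) = ∑ c, x none c (a (removeNone σ b)) *
        (x (some b) (a b) c * ∏ i ∈ Finset.univ.erase b,
          x (some i) (a i) (a (removeNone σ i))) := by
    intro a
    rw [← Finset.mul_prod_erase _ _ (Finset.mem_univ b), Function.update_self, Matrix.mul_apply,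
      Finset.sum_mul]
    refine Finset.sum_congr rfl fun c _ => ?_
    rw [mul_comm (x (some b) _ _), mul_assoc]
    congr 2
    refine Finset.prod_congr rfl fun i hi => ?_
    rw [Function.update_of_ne (Finset.ne_of_mem_erase hi), Function.comp_apply]
  simp only [permTrace, key]
  rw [Finset.sum_comm, ← Finset.sum_product', Finset.univ_product_univ]
  refine Fintype.sum_equiv Equiv.piOptionEquivProd _ _ fun a => ?_
  rw [Fintype.prod_option, hb, ← Finset.mul_prod_erase _ _ (Finset.mem_univ b), h]
  simp only [Equiv.piOptionEquivProd, Equiv.coe_fn_mk]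
  congr 2
  refine Finset.prod_congr rfl fun i hi => ?_
  rw [hs i (Finset.ne_of_mem_erase hi)]

theorem sign_removeNone_of_ne (σ : Perm (Option ι)) (h : σ none ≠ none) :
    sign (removeNone σ) = - sign σ := by
  rw [← optionCongr_sign, map_equiv_removeNone, Perm.sign_mul, sign_swap h.symm]
  simp

/-- The trace of a product of matrices is a generalized trace of its factors. -/
theorem exists_permTrace_eq_trace_prod [DecidableEq n] (k : ℕ) (x : Fin (k + 1) → Matrix n n R) :
    ∃ σ : Perm (Fin (k + 1)), permTrace σ x = trace (List.ofFn x).prod := by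
  induction k with
  | zero =>
    refine ⟨1, ?_⟩
    simp only [permTrace, Fin.prod_univ_succ, Matrix.trace, Nat.reduceAdd]
    refine Fintype.sum_equiv (Equiv.funUnique (Fin 1) n) _ _ fun a => ?_
    simp
  | succ k ih =>
    obtain ⟨σ, hσ⟩ := ih (Function.update (x ∘ Fin.castSucc) (Fin.last k)
      (x (Fin.last k).castSucc * x (Fin.last (k + 1))))
    let τ : Perm (Option (Fin (k + 1))) := decomposeOption.symm (some (σ (Fin.last k)), σ)
    have hτ : removeNone τ = σ :=
      congrArg Prod.snd (decomposeOption.apply_symm_apply (some (σ (Fin.last k)), σ))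
    let e : Fin (k + 2) ≃ Option (Fin (k + 1)) := finSuccEquivLast
    refine ⟨(e.trans τ).trans e.symm, ?_⟩
    have hx : x = (x ∘ e.symm) ∘ e := by
      funext i
      simp
    rw [hx, permTrace_comp_equiv, permTrace_option_of_some τ _ (Fin.last k) (by simp [τ]), hτ,
      ← hx]
    have hy : Function.update ((x ∘ e.symm) ∘ some) (Fin.last k)
        ((x ∘ e.symm) (some (Fin.last k)) * (x ∘ e.symm) none) =
        Function.update (x ∘ Fin.castSucc) (Fin.last k)
          (x (Fin.last k).castSucc * x (Fin.last (k + 1))) := by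
      simp [e, Function.comp_def]
    rw [hy, hσ, List.ofFn_succ', List.ofFn_succ', List.ofFn_succ']
    simp [Fin.castSucc_ne_last, List.concat_eq_append]

variable {K : Type*} [CommSemiring K] {A : Type*} [CommSemiring A] [Algebra K A] {s : Type*}
  [DecidableEq n]

/-- The algebra generated by the traces of words of length at most `L` in the matrices `U`. -/
def traceAlgebra (K : Type*) [CommSemiring K] [Algebra K A] (U : s → Matrix n n A) (L : ℕ) :
    Subalgebra K A :=
  Algebra.adjoin K {p | ∃ w : List s, w ≠ [] ∧ w.length ≤ L ∧ p = trace (w.map U).prod}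

theorem trace_mem_traceAlgebra {U : s → Matrix n n A} {L : ℕ} {w : List s} (h0 : w ≠ [])
    (hL : w.length ≤ L) : trace (w.map U).prod ∈ traceAlgebra K U L :=
  Algebra.subset_adjoin ⟨w, h0, hL, rfl⟩

/-- A generalized trace of words lies in the algebra generated by the traces of words of at most
the total length; if the sign of the permutation shows that it is not a full cycle, then
words of smaller length suffice. -/
theorem permTrace_mem_traceAlgebra (U : s → Matrix n n A) (L : ℕ) :
    ∀ (σ : Perm ι) (w : ι → List s), (∀ i, w i ≠ []) →
      (∑ i, (w i).length ≤ L ∨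
        ∑ i, (w i).length ≤ L + 1 ∧ sign σ ≠ (-1) ^ (Fintype.card ι + 1)) →
      permTrace σ (fun i => ((w i).map U).prod) ∈ traceAlgebra K U L := by
  classical
  refine Fintype.induction_empty_option (P := fun ι _ =>
      ∀ [DecidableEq ι] (σ : Perm ι) (w : ι → List s), (∀ i, w i ≠ []) →
      (∑ i, (w i).length ≤ L ∨
        ∑ i, (w i).length ≤ L + 1 ∧ sign σ ≠ (-1) ^ (Fintype.card ι + 1)) →
      permTrace σ (fun i => ((w i).map U).prod) ∈ traceAlgebra K U L) ?_ ?_ ?_ ι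
  · intro α β _ e ih _ σ w hw h
    let := Fintype.ofEquiv β e.symm
    let := e.decidableEq
    rw [← permTrace_comp_equiv e]
    refine ih _ (w ∘ e) (fun i => hw _) ?_
    have h1 : ∑ i, ((w ∘ e) i).length = ∑ i, (w i).length :=
      Fintype.sum_equiv e _ _ fun i => rfl
    have h2 : sign ((e.trans σ).trans e.symm) = sign σ := by
      simp
    rw [h1, h2, Fintype.card_congr e]
    exact h
  · intro _ σ w _ _
    rw [permTrace_of_isEmpty]
    exact one_mem _
  · intro α _ ih inst σ w hw h
    obtain rfl : inst = Option.instDecidableEq := Subsingleton.elim _ _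
    rw [Fintype.sum_option, Fintype.card_option] at h
    have hpos : ∀ i, 1 ≤ (w i).length := fun i => List.length_pos_iff.2 (hw i)
    by_cases hσ : σ none = none
    · rw [permTrace_option_of_fixed σ _ hσ]
      have hn := hpos none
      refine mul_mem (trace_mem_traceAlgebra (hw _) ?_)
        (ih (removeNone σ) (w ∘ some) (fun i => hw _) (Or.inl ?_))
      · rcases h with h | ⟨h, hs⟩
        · omega
        · rcases isEmpty_or_nonempty α with he | ⟨⟨a⟩⟩
          · exact absurd (by rw [Subsingleton.elim σ 1]; simp) hs
          · have h1 : (w (some a)).length ≤ ∑ i, (w (some i)).length :=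
              Finset.single_le_sum (f := fun i => (w (some i)).length)
                (fun _ _ => Nat.zero_le _) (Finset.mem_univ a)
            have h2 := hpos (some a)
            omega
      · simp only [Function.comp_apply]
        omega
    · obtain ⟨b, hb⟩ : ∃ b, σ (some b) = none := by
        obtain ⟨c, hc⟩ := σ.surjective none
        cases c with
        | none => exact absurd hc hσ
        | some b => exact ⟨b, hc⟩
      rw [permTrace_option_of_some σ _ b hb]
      have hw' : Function.update ((fun i => ((w i).map U).prod) ∘ some) b
          (((w (some b)).map U).prod * ((w none).map U).prod) =
          fun i => ((Function.update (w ∘ some) b (w (some b) ++ w none) i).map U).prod := by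
        funext i
        rcases eq_or_ne i b with rfl | hi
        · simp
        · simp [hi]
      rw [hw']
      have hlen : ∑ i, (Function.update (w ∘ some) b (w (some b) ++ w none) i).length =
          (w none).length + ∑ i, (w (some i)).length := by
        rw [← Finset.add_sum_erase _ _ (Finset.mem_univ b),
          ← Finset.add_sum_erase _ (fun i => (w (some i)).length) (Finset.mem_univ b),
          Function.update_self, List.length_append, Finset.sum_congr rfl fun i hi => by
            rw [Function.update_of_ne (Finset.ne_of_mem_erase hi)]]
        simp only [Function.comp_apply]
        omega
      refine ih _ _ (fun i => ?_) ?_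
      · rcases eq_or_ne i b with rfl | hi
        · simp [hw]
        · simp [hi, hw]
      · rw [hlen, sign_removeNone_of_ne σ hσ]
        refine h.imp_right (And.imp_right fun hs h' => hs ?_)
        rw [pow_succ, ← h', mul_neg_one, neg_neg]

end PermTrace

/-- The permutation representation of `Perm ι` on the tensor power `(K ^ n) ^ ⊗ ι`, whose elements
are given by their coordinates. -/
def tensorRep (K ι n : Type*) [CommSemiring K] : Representation K (Perm ι) ((ι → n) → K) where
  toFun σ := LinearMap.funLeft K K fun a : ι → n => a ∘ σ
  map_one' := rfl
  map_mul' _ _ := rfl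

theorem tensorRep_apply {K ι n : Type*} [CommSemiring K] (σ : Perm ι) (v : (ι → n) → K)
    (a : ι → n) : tensorRep K ι n σ v a = v (a ∘ σ) := rfl

/-- The trace of `T` composed with the tensor product of the matrices `x i`. -/
noncomputable def tensorTrace (K : Type*) {ι n A : Type*} [Fintype ι] [DecidableEq ι] [Fintype n]
    [DecidableEq n] [CommSemiring K] [CommSemiring A] [Algebra K A] (x : ι → Matrix n n A) :
    Module.End K ((ι → n) → K) →ₗ[K] A where
  toFun T := ∑ a : ι → n, ∑ b : ι → n, T (Pi.single b 1) a • ∏ i, x i (a i) (b i)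
  map_add' S T := by simp [add_smul, Finset.sum_add_distrib]
  map_smul' c T := by simp [Finset.smul_sum, smul_smul]

section Reduction

variable {K ι n A : Type*} [Fintype ι] [DecidableEq ι] [Fintype n] [Field K]
  [CommRing A] [Algebra K A]

/-- The permutations fixing every point outside `S`. -/
def permsOn (S : Finset ι) : Finset (Perm ι) := {σ | ∀ i ∉ S, σ i = i}

variable (K) in
/-- The sum of all permutations of `S`. -/
noncomputable def symmetrizer (S : Finset ι) : MonoidAlgebra K (Perm ι) :=
  ∑ σ ∈ permsOn S, MonoidAlgebra.single σ 1

variable (K) in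
/-- The signed sum of all permutations of `S`. -/
noncomputable def antisymmetrizer (S : Finset ι) : MonoidAlgebra K (Perm ι) :=
  ∑ σ ∈ permsOn S, MonoidAlgebra.single σ ((sign σ : ℤ) : K)

theorem asAlgebraHom_antisymmetrizer (S : Finset ι) (hS : Fintype.card n < S.card) :
    (tensorRep K ι n).asAlgebraHom (antisymmetrizer K S) = 0 := by
  refine LinearMap.ext fun v => funext fun a => ?_
  obtain ⟨i, hi, j, hj, hij, ha⟩ := Finset.exists_ne_map_eq_of_card_lt_of_maps_to
    (t := Finset.univ) hS (f := a) (fun _ _ => Finset.mem_univ _)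
  simp only [antisymmetrizer, map_sum, Representation.asAlgebraHom_single, LinearMap.sum_apply,
    LinearMap.smul_apply, Finset.sum_apply, Pi.smul_apply, tensorRep_apply, LinearMap.zero_apply,
    Pi.zero_apply]
  have hswap : a ∘ Equiv.swap i j = a := by
    funext k
    rcases eq_or_ne k i with rfl | hki
    · simp [ha]
    rcases eq_or_ne k j with rfl | hkj
    · simp [ha]
    · simp [swap_apply_of_ne_of_ne hki hkj]
  refine Finset.sum_involution (fun σ _ => Equiv.swap i j * σ) ?_ ?_ ?_ ?_
  · intro σ _
    have : a ∘ (Equiv.swap i j * σ : Perm ι) = a ∘ σ := by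
      rw [Perm.coe_mul, ← Function.comp_assoc, hswap]
    rw [this]
    simp [sign_swap hij]
  · intro σ _ _ h
    exact hij (swap_eq_one_iff.1 (mul_eq_right.1 h))
  · intro σ hσ
    simp only [permsOn, Finset.mem_filter, Finset.mem_univ, true_and, Perm.mul_apply] at hσ ⊢
    intro k hk
    rw [hσ k hk]
    exact swap_apply_of_ne_of_ne (fun h => hk (h ▸ hi)) fun h => hk (h ▸ hj)
  · intro σ _
    simp

variable [DecidableEq n]

theorem tensorTrace_tensorRep (x : ι → Matrix n n A) (σ : Perm ι) :
    tensorTrace K x (tensorRep K ι n σ) = permTrace σ x := by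
  refine Finset.sum_congr rfl fun a _ => ?_
  rw [Finset.sum_eq_single (a ∘ σ)]
  · simp [tensorRep_apply]
  · intro b _ hb
    simp [tensorRep_apply, hb.symm]
  · simp

theorem tensorTrace_asAlgebraHom_mem_span (x : ι → Matrix n n A) (z : MonoidAlgebra K (Perm ι)) :
    tensorTrace K x ((tensorRep K ι n).asAlgebraHom z) ∈
      Submodule.span K (Set.range fun σ => permTrace σ x) := by
  induction z using MonoidAlgebra.induction_linear with
  | zero => simp
  | add y z hy hz => simpa using add_mem hy hz
  | single σ c =>
    rw [Representation.asAlgebraHom_single, map_smul, tensorTrace_tensorRep]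
    exact Submodule.smul_mem _ _ (Submodule.subset_span ⟨σ, rfl⟩)

theorem eq_zero_of_symmetrizer_eq_zero [CharZero K] (hι : Fintype.card n ^ 2 < Fintype.card ι)
    (v : (ι → n) → K)
    (hv : ∀ S : Finset ι, Fintype.card n < S.card →
      (tensorRep K ι n).asAlgebraHom (symmetrizer K S) v = 0) : v = 0 := by
  funext a
  obtain ⟨c, hc⟩ := Fintype.exists_lt_card_fiber_of_mul_lt_card (f := a)
    (n := Fintype.card n) (by rwa [← sq])
  have h := congrFun (hv _ hc) a
  simp only [symmetrizer, map_sum, Representation.asAlgebraHom_single, LinearMap.sum_apply,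
    Finset.sum_apply, tensorRep_apply, one_smul, Pi.zero_apply] at h
  rw [Finset.sum_congr rfl (g := fun _ => v a), Finset.sum_const, nsmul_eq_mul] at h
  · refine (mul_eq_zero.1 h).resolve_left (Nat.cast_ne_zero.2 (Finset.card_ne_zero.2 ⟨1, ?_⟩))
    simp [permsOn]
  · intro σ hσ
    congr 1
    funext k
    simp only [permsOn, Finset.mem_filter, Finset.mem_univ, true_and] at hσ
    by_cases hk : a k = c
    · by_contra hne
      have h1 : a (σ k) ≠ c := fun h => hne (h.trans hk.symm)
      exact hne (congrArg a (σ.injective (hσ _ h1)))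
    · exact congrArg a (hσ k hk)

/-- Modulo the kernel of the action on the tensor power, the symmetrizers generate the unit ideal
of the group algebra. -/
theorem exists_mem_span_symmetrizer [CharZero K] (hι : Fintype.card n ^ 2 < Fintype.card ι) :
    ∃ e ∈ Submodule.span (MonoidAlgebra K (Perm ι))
        {z | ∃ S : Finset ι, Fintype.card n < S.card ∧ z = symmetrizer K S},
      (tensorRep K ι n).asAlgebraHom e = 1 := by
  set I := Submodule.span (MonoidAlgebra K (Perm ι))
    {z | ∃ S : Finset ι, Fintype.card n < S.card ∧ z = symmetrizer K S} with hI
  have : NeZero (Nat.card (Perm ι) : K) := ⟨Nat.cast_ne_zero.2 Nat.card_pos.ne'⟩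
  obtain ⟨J, hJ⟩ := MonoidAlgebra.Submodule.exists_isCompl I
  obtain ⟨e, he, e', he', h1⟩ := Submodule.mem_sup.1
    (hJ.sup_eq_top.ge (Submodule.mem_top (x := (1 : MonoidAlgebra K (Perm ι)))))
  refine ⟨e, he, ?_⟩
  have hann : ∀ x ∈ I, x * e' = 0 := by
    intro x hx
    refine Submodule.disjoint_def.1 hJ.disjoint _ ?_ (J.smul_mem x he')
    have : x * e' = x - x * e := by
      rw [eq_sub_iff_add_eq, ← mul_add, add_comm, h1, mul_one]
    rw [this]
    exact I.sub_mem hx (I.smul_mem x he)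
  have he0 : (tensorRep K ι n).asAlgebraHom e' = 0 := by
    refine LinearMap.ext fun v => eq_zero_of_symmetrizer_eq_zero hι _ fun S hS => ?_
    rw [← Module.End.mul_apply, ← map_mul, hann _ (Submodule.subset_span ⟨S, hS, rfl⟩)]
    simp
  rw [← map_one (tensorRep K ι n).asAlgebraHom, ← h1, map_add, he0, add_zero]

theorem tensorTrace_mul_symmetrizer_mem_span (x : ι → Matrix n n A) (S : Finset ι)
    (hS : Fintype.card n < S.card) (ε : ℤˣ) (z : MonoidAlgebra K (Perm ι)) :
    tensorTrace K x ((tensorRep K ι n).asAlgebraHom (z * symmetrizer K S)) ∈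
      Submodule.span K {p | ∃ τ : Perm ι, sign τ = ε ∧ p = permTrace τ x} := by
  induction z using MonoidAlgebra.induction_linear with
  | zero => simp
  | add y z hy hz => simpa [add_mul] using add_mem hy hz
  | single g c =>
    have halt : tensorTrace K x ((tensorRep K ι n).asAlgebraHom
        (MonoidAlgebra.single g (c * ((ε * sign g : ℤˣ) : ℤ)) * antisymmetrizer K S)) = 0 := by
      rw [map_mul, asAlgebraHom_antisymmetrizer S hS, mul_zero, map_zero]
    rw [← add_zero (tensorTrace K x _), ← halt, ← map_add, ← map_add, symmetrizer,
      antisymmetrizer, Finset.mul_sum, Finset.mul_sum, ← Finset.sum_add_distrib, map_sum, map_sum]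
    refine Submodule.sum_mem _ fun σ _ => ?_
    simp only [MonoidAlgebra.single_mul_single, ← MonoidAlgebra.single_add,
      Representation.asAlgebraHom_single, map_smul, tensorTrace_tensorRep]
    by_cases h : sign (g * σ) = ε
    · exact Submodule.smul_mem _ _ (Submodule.subset_span ⟨_, h, rfl⟩)
    · have h' : sign g * sign σ = -ε := by
        rw [← Perm.sign_mul]
        exact Int.units_ne_iff_eq_neg.1 h
      have : ((ε * sign g : ℤˣ) : K) * ((sign σ : ℤ) : K) = -1 := by
        rw [← Int.cast_mul, ← Units.val_mul, mul_assoc, h']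
        simp
      rw [mul_one, mul_assoc, this]
      simp

theorem permTrace_mem_span_sign [CharZero K] (hι : Fintype.card n ^ 2 < Fintype.card ι)
    (x : ι → Matrix n n A) (ε : ℤˣ) (σ : Perm ι) :
    permTrace σ x ∈ Submodule.span K {p | ∃ τ : Perm ι, sign τ = ε ∧ p = permTrace τ x} := by
  obtain ⟨e, he, h1⟩ := exists_mem_span_symmetrizer (K := K) hι
  have key : ∀ z ∈ Submodule.span (MonoidAlgebra K (Perm ι))
      {z | ∃ S : Finset ι, Fintype.card n < S.card ∧ z = symmetrizer K S},
      tensorTrace K x ((tensorRep K ι n).asAlgebraHom z) ∈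
        Submodule.span K {p | ∃ τ : Perm ι, sign τ = ε ∧ p = permTrace τ x} := by
    intro z hz
    induction hz using Submodule.closure_induction with
    | zero => simp
    | add y z _ _ hy hz => simpa using add_mem hy hz
    | smul_mem r z hz =>
      obtain ⟨S, hS, rfl⟩ := hz
      exact tensorTrace_mul_symmetrizer_mem_span x S hS ε r
  have h := key _ (Submodule.smul_mem _ (MonoidAlgebra.single σ 1) he)
  rwa [smul_eq_mul, map_mul, h1, mul_one, Representation.asAlgebraHom_single, one_smul,
    tensorTrace_tensorRep] at h

end Reduction

section Razmyslov

theorem List.exists_ofFn_flatten_eq {α : Type*} (N : ℕ) (w : List α) (hw : N < w.length) :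
    ∃ W : Fin (N + 1) → List α, (∀ i, W i ≠ []) ∧ (List.ofFn W).flatten = w := by
  induction N generalizing w with
  | zero => exact ⟨fun _ => w, fun _ => List.length_pos_iff.1 hw, by simp⟩
  | succ N ih =>
    cases w with
    | nil => simp at hw
    | cons a w =>
      obtain ⟨W, hW, rfl⟩ := ih w (by simpa using hw)
      refine ⟨Fin.cons [a] W, Fin.cases (by simp) (by simpa using hW), ?_⟩
      rw [List.ofFn_succ]
      simp

variable {K n A s : Type*} [Fintype n] [DecidableEq n] [Field K] [CharZero K] [CommRing A]
  [Algebra K A]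

/-- Razmyslov's bound: the trace of every word lies in the algebra generated by the traces of words
of length at most the square of the size of the matrices. -/
theorem trace_prod_mem_traceAlgebra_sq (U : s → Matrix n n A) (w : List s) (hw : w ≠ []) :
    trace (w.map U).prod ∈ traceAlgebra K U (Fintype.card n ^ 2) := by
  induction h : w.length using Nat.strong_induction_on generalizing w with
  | _ k ih =>
  set N := Fintype.card n ^ 2 with hN
  rcases le_or_gt w.length N with hle | hlt
  · exact trace_mem_traceAlgebra hw hle
  have hsub : traceAlgebra K U (k - 1) ≤ traceAlgebra K U N := by
    refine Algebra.adjoin_le ?_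
    rintro _ ⟨v, hv, hvk, rfl⟩
    have := List.length_pos_iff.2 hv
    exact ih v.length (by omega) v hv rfl
  refine hsub ?_
  obtain ⟨W, hW, hWflat⟩ :=
    List.exists_ofFn_flatten_eq N w hlt
  obtain ⟨σ, hσ⟩ := exists_permTrace_eq_trace_prod N fun i => ((W i).map U).prod
  have hprod : (List.ofFn fun i => ((W i).map U).prod).prod = (w.map U).prod := by
    rw [← hWflat, List.map_flatten, List.prod_flatten, List.map_ofFn, List.map_ofFn]
    rfl
  have hlen : ∑ i, (W i).length = k := by
    rw [← h, ← hWflat, List.length_flatten, List.map_ofFn, List.sum_ofFn]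
    rfl
  rw [← hprod, ← hσ]
  refine Submodule.span_le (p := Subalgebra.toSubmodule (traceAlgebra K U (k - 1))).2 ?_
    (permTrace_mem_span_sign (K := K) (by simp [hN]) _ ((-1) ^ N * (-1)) σ)
  rintro _ ⟨τ, hτ, rfl⟩
  refine permTrace_mem_traceAlgebra U (k - 1) τ W hW (Or.inr ⟨by omega, ?_⟩)
  rw [hτ, Fintype.card_fin, pow_succ, pow_succ]
  simp

end Razmyslov

section SymmetricTensor

variable {ι κ K : Type*} [Fintype ι] [DecidableEq ι] [Fintype κ] [DecidableEq κ] [Field K]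

/-- The exponent of the monomial `∏ₖ X (p k)`. -/
noncomputable def tupleExponent (p : ι → κ) : κ →₀ ℕ := ∑ k, Finsupp.single (p k) 1

theorem prod_X_eq_monomial (p : ι → κ) :
    ∏ k, (X (p k) : MvPolynomial κ K) = monomial (tupleExponent p) 1 := by
  rw [tupleExponent, monomial_sum_one]
  rfl

theorem tupleExponent_apply (p : ι → κ) (c : κ) :
    tupleExponent p c = Fintype.card {k // p k = c} := by
  simp [tupleExponent, Finsupp.single_apply, Fintype.card_subtype]

theorem tupleExponent_comp (p : ι → κ) (σ : Perm ι) :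
    tupleExponent (p ∘ σ) = tupleExponent p :=
  Equiv.sum_comp σ fun k => Finsupp.single (p k) 1

theorem exists_comp_perm_of_tupleExponent_eq {p q : ι → κ}
    (h : tupleExponent p = tupleExponent q) : ∃ σ : Perm ι, q ∘ σ = p := by
  have e : ∀ c, {k // p k = c} ≃ {k // q k = c} := fun c => Fintype.equivOfCardEq (by
    rw [← tupleExponent_apply, ← tupleExponent_apply, h])
  exact ⟨Equiv.ofFiberEquiv e, funext (Equiv.ofFiberEquiv_map e)⟩

theorem exists_tupleExponent_eq {d : ℕ} {ν : κ →₀ ℕ} (h : ν.degree = d) :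
    ∃ p : Fin d → κ, tupleExponent p = ν := by
  classical
  have hcard : ν.toMultiset.toList.length = d := by
    rw [Multiset.length_toList, Finsupp.card_toMultiset, ← h]
    rfl
  subst hcard
  refine ⟨fun k => ν.toMultiset.toList.get k, Multiset.toFinsupp.symm.injective ?_⟩
  change Finsupp.toMultiset _ = Finsupp.toMultiset _
  rw [tupleExponent, map_sum]
  simp only [Finsupp.toMultiset_single, one_smul]
  conv_rhs => rw [← Multiset.coe_toList ν.toMultiset, ← List.ofFn_get ν.toMultiset.toList]
  refine Eq.trans ?_ (Multiset.sum_map_singleton _)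
  rw [Multiset.map_coe, Multiset.sum_coe, List.map_ofFn, List.sum_ofFn]
  rfl

/-- A tensor all of whose contractions against powers vanish is orthogonal to every symmetric
tensor. -/
theorem sum_mul_eq_zero_of_symmetric {l s : (ι → κ) → K}
    (hl : ∑ p, C (l p) * ∏ k, (X (p k) : MvPolynomial κ K) = 0)
    (hs : ∀ (σ : Perm ι) p, s (p ∘ σ) = s p) : ∑ p, l p * s p = 0 := by
  classical
  let S : (κ →₀ ℕ) → K := fun ν => if h : ∃ p : ι → κ, tupleExponent p = ν then s h.choose else 0
  have hS : ∀ p, S (tupleExponent p) = s p := by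
    intro p
    have h : ∃ q : ι → κ, tupleExponent q = tupleExponent p := ⟨p, rfl⟩
    simp only [S, dif_pos h]
    obtain ⟨σ, hσ⟩ := exists_comp_perm_of_tupleExponent_eq h.choose_spec
    rw [← hσ, hs]
  have h := congrArg ((basisMonomials κ K).constr K S) hl
  rw [map_sum, map_zero] at h
  rw [← h]
  refine Finset.sum_congr rfl fun p _ => ?_
  have : C (l p) * ∏ k, (X (p k) : MvPolynomial κ K) =
      l p • basisMonomials κ K (tupleExponent p) := by
    rw [prod_X_eq_monomial, coe_basisMonomials, C_mul']
  rw [this, map_smul, Module.Basis.constr_basis, hS, smul_eq_mul]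

theorem eq_zero_of_symmetric [CharZero K] {t : (ι → κ) → K}
    (ht : ∑ p, C (t p) * ∏ k, (X (p k) : MvPolynomial κ K) = 0)
    (hs : ∀ (σ : Perm ι) p, t (p ∘ σ) = t p) : t = 0 := by
  classical
  funext q
  have h := sum_mul_eq_zero_of_symmetric ht
    (s := fun p => if tupleExponent p = tupleExponent q then 1 else 0)
    (fun σ p => by rw [tupleExponent_comp])
  simp only [mul_ite, mul_one, mul_zero] at h
  rw [← Finset.sum_filter, Finset.sum_congr rfl (g := fun _ => t q), Finset.sum_const,
    nsmul_eq_mul] at h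
  · refine (mul_eq_zero.1 h).resolve_left (Nat.cast_ne_zero.2 (Finset.card_ne_zero.2 ⟨q, ?_⟩))
    simp
  · intro p hp
    obtain ⟨σ, rfl⟩ := exists_comp_perm_of_tupleExponent_eq (Finset.mem_filter.1 hp).2
    exact hs σ q

theorem exists_symmetric_of_isHomogeneous [CharZero K] {d : ℕ} {f : MvPolynomial κ K}
    (hf : f.IsHomogeneous d) :
    ∃ t : (Fin d → κ) → K, (∀ (σ : Perm (Fin d)) p, t (p ∘ σ) = t p) ∧
      f = ∑ p, C (t p) * ∏ k, X (p k) := by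
  classical
  refine ⟨fun p => coeff (tupleExponent p) f /
    (Finset.univ.filter fun q : Fin d → κ => tupleExponent q = tupleExponent p).card,
    fun σ p => by simp only [tupleExponent_comp], ?_⟩
  ext ν
  simp only [coeff_sum, prod_X_eq_monomial, coeff_C_mul, coeff_monomial, mul_ite, mul_one,
    mul_zero]
  rw [← Finset.sum_filter, Finset.sum_congr rfl (g := fun _ => coeff ν f /
    (Finset.univ.filter fun q : Fin d → κ => tupleExponent q = ν).card), Finset.sum_const,
    nsmul_eq_mul]
  · by_cases h0 : coeff ν f = 0
    · simp [h0]
    · obtain ⟨p, hp⟩ := exists_tupleExponent_eq (d := d) (by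
        rw [← hf h0, Finsupp.degree_eq_weight_one]
        rfl)
      rw [mul_div_cancel₀]
      exact Nat.cast_ne_zero.2 (Finset.card_ne_zero.2 ⟨p, by simpa using hp⟩)
  · intro p hp
    rw [(Finset.mem_filter.1 hp).2]

end SymmetricTensor

section SchurWeyl

variable {ι n : Type*} [Fintype ι] [DecidableEq ι] [Fintype n]

/-- The Kronecker product of a finite family of square matrices. -/
def tensorMatrix {R : Type*} [CommSemiring R] (x : ι → Matrix n n R) :
    Matrix (ι → n) (ι → n) R :=
  Matrix.of fun a b => ∏ i, x i (a i) (b i)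

theorem tensorMatrix_mul {R : Type*} [CommSemiring R] (x y : ι → Matrix n n R) :
    tensorMatrix (fun i => x i * y i) = tensorMatrix x * tensorMatrix y := by
  ext a b
  simp only [tensorMatrix, Matrix.of_apply, Matrix.mul_apply, Finset.prod_univ_sum,
    Fintype.piFinset_univ, Finset.prod_mul_distrib]

variable [DecidableEq n]

theorem tensorMatrix_one {R : Type*} [CommSemiring R] :
    tensorMatrix (fun _ : ι => (1 : Matrix n n R)) = 1 := by
  ext a b
  simp only [tensorMatrix, Matrix.of_apply, Matrix.one_apply, Finset.prod_ite_zero, funext_iff,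
    Finset.prod_const_one, Finset.mem_univ, true_implies]

variable {K : Type*} [Field K]

theorem tensorTrace_toLin' {A : Type*} [CommRing A] [Algebra K A] (x : ι → Matrix n n A)
    (T : Matrix (ι → n) (ι → n) K) :
    tensorTrace K x (Matrix.toLin' T) = ∑ a, ∑ b, T a b • tensorMatrix x a b := by
  simp [tensorTrace, tensorMatrix, Matrix.toLin'_apply]

/-- A matrix commuting with all tensor powers of invertible matrices commutes with every matrix
invariant under simultaneous permutation of the tensor factors. -/
theorem mul_comm_of_forall_tensorMatrix [CharZero K] (T : Matrix (ι → n) (ι → n) K)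
    (hT : ∀ g : GL n K, tensorMatrix (fun _ : ι => (g : Matrix n n K)) * T =
      T * tensorMatrix (fun _ : ι => (g : Matrix n n K)))
    (Y : Matrix (ι → n) (ι → n) K) (hY : ∀ (σ : Perm ι) a b, Y (a ∘ σ) (b ∘ σ) = Y a b) :
    Y * T = T * Y := by
  ext u v
  let l : (ι → n × n) → K := fun p =>
    (if u = Prod.fst ∘ p then T (Prod.snd ∘ p) v else 0) -
      (if Prod.snd ∘ p = v then T u (Prod.fst ∘ p) else 0)
  have hsum : ∀ Z : Matrix (ι → n) (ι → n) K,
      ∑ p, l p * Z (Prod.fst ∘ p) (Prod.snd ∘ p) = (Z * T) u v - (T * Z) u v := by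
    intro Z
    refine (Fintype.sum_equiv (Equiv.arrowProdEquivProdArrow ι (fun _ => n) fun _ => n) _
      (fun q : (ι → n) × (ι → n) => ((if u = q.1 then T q.2 v else 0) -
        (if q.2 = v then T u q.1 else 0)) * Z q.1 q.2) (fun p => rfl)).trans ?_
    rw [Fintype.sum_prod_type]
    simp only [sub_mul, Finset.sum_sub_distrib, ite_mul, zero_mul, Matrix.mul_apply]
    rw [Finset.sum_comm]
    simp [mul_comm]
  have hl : ∑ p, C (l p) * ∏ k, (X (p k) : MvPolynomial (n × n) K) = 0 := by
    refine eq_of_eval_eq_on_gl fun g => ?_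
    have h := hsum (tensorMatrix fun _ => (g : Matrix n n K))
    rw [hT g, sub_self] at h
    simpa [tensorMatrix, eval_prod] using h
  have := sum_mul_eq_zero_of_symmetric hl
    (s := fun p => Y (Prod.fst ∘ p) (Prod.snd ∘ p)) fun σ p => hY σ (Prod.fst ∘ p) (Prod.snd ∘ p)
  rw [hsum] at this
  exact sub_eq_zero.1 this

/-- Schur–Weyl duality: a matrix commuting with the tensor powers of all invertible matrices is a
linear combination of permutations of the tensor factors. -/
theorem exists_asAlgebraHom_eq_toLin' [CharZero K] (T : Matrix (ι → n) (ι → n) K)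
    (hT : ∀ g : GL n K, tensorMatrix (fun _ : ι => (g : Matrix n n K)) * T =
      T * tensorMatrix (fun _ : ι => (g : Matrix n n K))) :
    ∃ z, (tensorRep K ι n).asAlgebraHom z = Matrix.toLin' T := by
  let ρ := tensorRep K ι n
  have : NeZero (Nat.card (Perm ι) : K) := ⟨Nat.cast_ne_zero.2 Nat.card_pos.ne'⟩
  have hcomm : ∀ (φ : Module.End (MonoidAlgebra K (Perm ι)) ρ.asModule) (v : ρ.asModule),
      ρ.asModuleEquiv.symm (Matrix.toLin' T (ρ.asModuleEquiv (φ v))) =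
        φ (ρ.asModuleEquiv.symm (Matrix.toLin' T (ρ.asModuleEquiv v))) := by
    intro φ
    let φ' : Module.End K ((ι → n) → K) :=
      ρ.asModuleEquiv.toLinearMap ∘ₗ φ.restrictScalars K ∘ₗ ρ.asModuleEquiv.symm.toLinearMap
    have hφ' : ∀ v, φ' v = ρ.asModuleEquiv (φ (ρ.asModuleEquiv.symm v)) := fun _ => rfl
    have hφ : ∀ (σ : Perm ι) v, φ' (ρ σ v) = ρ σ (φ' v) := by
      intro σ v
      rw [hφ', hφ', ρ.asModuleEquiv_symm_map_rho, map_smul, ρ.asModuleEquiv_map_smul,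
        ρ.asAlgebraHom_of]
    have hY := mul_comm_of_forall_tensorMatrix T hT (LinearMap.toMatrix' φ') (by
      intro σ a b
      have h1 : ρ σ (Pi.single (b ∘ σ) 1) = Pi.single b 1 := by
        funext c
        have : c ∘ σ = b ∘ σ ↔ c = b := σ.surjective.right_cancellable
        simp [ρ, tensorRep_apply, Pi.single_apply, this]
      simp only [LinearMap.toMatrix'_apply]
      rw [← h1, hφ]
      rfl)
    intro v
    have := congrArg (fun M => Matrix.toLin' M (ρ.asModuleEquiv v)) hY
    simp only [Matrix.toLin'_mul, Matrix.toLin'_toMatrix', LinearMap.comp_apply, hφ',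
      LinearEquiv.symm_apply_apply] at this
    rw [← this, LinearEquiv.symm_apply_apply]
  let F : Module.End (Module.End (MonoidAlgebra K (Perm ι)) ρ.asModule) ρ.asModule :=
    { toFun := fun v => ρ.asModuleEquiv.symm (Matrix.toLin' T (ρ.asModuleEquiv v))
      map_add' := fun v w => by simp only [map_add]
      map_smul' := hcomm }
  classical
  obtain ⟨z, hz⟩ := jacobson_density F
    (Finset.univ.image fun b : ι → n => ρ.asModuleEquiv.symm (Pi.single b 1))
  refine ⟨z, LinearMap.pi_ext' fun b => LinearMap.ext_ring ?_⟩
  have h := congrArg ρ.asModuleEquiv (hz _ (Finset.mem_image_of_mem _ (Finset.mem_univ b)))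
  rw [ρ.asModuleEquiv_map_smul] at h
  simpa [F] using h.symm

end SchurWeyl

section Invariants

variable {K : Type*} [Field K] {r m : ℕ}

/-- The substitution `Uᵢ ↦ P Uᵢ Q` in the generic matrices. -/
noncomputable def conjSubst (P Q : Matrix (Fin m) (Fin m) K) :
    MvPolynomial (Fin r × Fin m × Fin m) K →ₐ[K] MvPolynomial (Fin r × Fin m × Fin m) K :=
  aeval fun p : Fin r × Fin m × Fin m =>
    (P.map C * genericMatrix K r m p.1 * Q.map C :
      Matrix (Fin m) (Fin m) (MvPolynomial (Fin r × Fin m × Fin m) K)) p.2.1 p.2.2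

theorem eval_conjSubst (P Q : Matrix (Fin m) (Fin m) K) (A : Fin r × Fin m × Fin m → K)
    (f : MvPolynomial (Fin r × Fin m × Fin m) K) :
    eval A (conjSubst P Q f) =
      eval (fun p => (P * (Matrix.of fun a b => A (p.1, a, b)) * Q) p.2.1 p.2.2) f := by
  have h : (eval A).comp
      (conjSubst P Q : _ →ₐ[K] MvPolynomial (Fin r × Fin m × Fin m) K).toRingHom =
      eval (fun p => (P * (Matrix.of fun a b => A (p.1, a, b)) * Q) p.2.1 p.2.2) := by
    refine MvPolynomial.ringHom_ext (fun c => ?_) fun p => ?_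
    · simp [conjSubst]
    · simp [conjSubst, Matrix.mul_apply, genericMatrix]
  exact congrArg (fun φ => φ f) h

theorem isHomogeneous_conjSubst (P Q : Matrix (Fin m) (Fin m) K) {d : ℕ}
    {f : MvPolynomial (Fin r × Fin m × Fin m) K} (hf : f.IsHomogeneous d) :
    (conjSubst P Q f).IsHomogeneous d := by
  rw [← one_mul d]
  refine hf.aeval _ fun p => ?_
  simp only [Matrix.mul_apply, Matrix.map_apply, genericMatrix, Matrix.of_apply]
  refine IsHomogeneous.sum _ _ _ fun a _ => ?_
  rw [← add_zero 1]
  refine IsHomogeneous.mul (IsHomogeneous.sum _ _ _ fun b _ => ?_) (isHomogeneous_C _ _)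
  rw [← zero_add 1]
  exact (isHomogeneous_C _ _).mul (isHomogeneous_X _ _)

theorem homogeneousComponent_conjSubst (P Q : Matrix (Fin m) (Fin m) K) (d : ℕ)
    (f : MvPolynomial (Fin r × Fin m × Fin m) K) :
    homogeneousComponent d (conjSubst P Q f) = conjSubst P Q (homogeneousComponent d f) := by
  conv_lhs => rw [← sum_homogeneousComponent f, map_sum, map_sum]
  rw [Finset.sum_congr rfl fun i _ => homogeneousComponent_of_mem
    (isHomogeneous_conjSubst P Q (homogeneousComponent_isHomogeneous i f))]
  rw [Finset.sum_ite_eq]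
  split_ifs with h
  · rfl
  · rw [homogeneousComponent_eq_zero, map_zero]
    simpa using h

theorem IsMatrixInvariant.conjSubst_eq [IsAlgClosed K] [CharZero K] (hm : 1 ≤ m)
    {f : MvPolynomial (Fin r × Fin m × Fin m) K} (hf : IsMatrixInvariant K r m f)
    {P Q : Matrix (Fin m) (Fin m) K} (hPQ : P * Q = 1) : conjSubst P Q f = f := by
  refine MvPolynomial.funext fun A => ?_
  have hdet : P.det ≠ 0 := fun h => by
    have := congrArg Matrix.det hPQ
    simp [h] at this
  obtain ⟨c, hc⟩ := IsAlgClosed.exists_pow_nat_eq P.det hm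
  have hc0 : c ≠ 0 := by
    rintro rfl
    rw [zero_pow (by omega)] at hc
    exact hdet hc.symm
  let S : Matrix.SpecialLinearGroup (Fin m) K := ⟨c⁻¹ • P, by
    rw [Matrix.det_smul, ← hc, Fintype.card_fin, ← mul_pow, inv_mul_cancel₀ hc0, one_pow]⟩
  have hS : (S⁻¹).1 = c • Q := by
    have h1 : (S⁻¹).1 * S.1 = 1 := congrArg Subtype.val (inv_mul_cancel S)
    have h2 : S.1 * (c • Q) = 1 := by
      simp [S, hPQ, smul_smul, hc0]
    exact left_inv_eq_right_inv h1 h2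
  have h := hf S fun i => Matrix.of fun a b => A (i, a, b)
  rw [hS] at h
  rw [eval_conjSubst]
  simpa [S, smul_smul, hc0] using h

theorem conjSubst_genericMatrix (P Q : Matrix (Fin m) (Fin m) K) (i : Fin r) :
    (genericMatrix K r m i).map (conjSubst P Q) =
      P.map C * genericMatrix K r m i * Q.map C := by
  refine Matrix.ext fun a b => ?_
  simp [conjSubst, genericMatrix]

theorem sum_tuple_eq {d : ℕ} (t : (Fin d → Fin r × Fin m × Fin m) → K) :
    ∑ p, C (t p) * ∏ k, (X (p k) : MvPolynomial (Fin r × Fin m × Fin m) K) =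
      ∑ i : Fin d → Fin r, ∑ a : Fin d → Fin m, ∑ b : Fin d → Fin m,
        t (fun k => (i k, a k, b k)) • tensorMatrix (fun k => genericMatrix K r m (i k)) a b := by
  let e : (Fin d → Fin r × Fin m × Fin m) ≃ (Fin d → Fin r) × (Fin d → Fin m) × (Fin d → Fin m) :=
    (Equiv.arrowProdEquivProdArrow _ _ _).trans
      (Equiv.prodCongr (Equiv.refl _) (Equiv.arrowProdEquivProdArrow _ _ _))
  refine (Fintype.sum_equiv e _ (fun q => t (fun k => (q.1 k, q.2.1 k, q.2.2 k)) •
    tensorMatrix (fun k => genericMatrix K r m (q.1 k)) q.2.1 q.2.2) fun p => ?_).trans ?_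
  · rw [C_mul']
    rfl
  · rw [Fintype.sum_prod_type]
    exact Finset.sum_congr rfl fun i _ => Fintype.sum_prod_type _

theorem conjSubst_tensorMatrix {d : ℕ} (P Q : Matrix (Fin m) (Fin m) K) (i : Fin d → Fin r) :
    (tensorMatrix fun k => genericMatrix K r m (i k)).map (conjSubst P Q) =
      (tensorMatrix fun _ => P).map C * (tensorMatrix fun k => genericMatrix K r m (i k)) *
        (tensorMatrix fun _ => Q).map C := by
  have h : ∀ M : Matrix (Fin m) (Fin m) K,
      (tensorMatrix fun _ : Fin d => M).map (C : K →+* MvPolynomial (Fin r × Fin m × Fin m) K) =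
      tensorMatrix fun _ => M.map C := by
    intro M
    refine Matrix.ext fun a b => ?_
    simp [tensorMatrix]
  rw [h, h, ← tensorMatrix_mul, ← tensorMatrix_mul]
  simp only [← conjSubst_genericMatrix]
  refine Matrix.ext fun a b => ?_
  simp [tensorMatrix]

theorem sum_smul_conj {R α : Type*} [Fintype α] [CommRing R] [Algebra K R]
    (T P Q : Matrix α α K) (Y : Matrix α α R) :
    ∑ a, ∑ b, T a b • (P.map (algebraMap K R) * Y * Q.map (algebraMap K R)) a b =
      ∑ a, ∑ b, (Pᵀ * T * Qᵀ) a b • Y a b := by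
  have h : ∀ (S : Matrix α α K) (Z : Matrix α α R),
      ∑ a, ∑ b, S a b • Z a b = trace ((S.map (algebraMap K R))ᵀ * Z) := by
    intro S Z
    rw [Finset.sum_comm]
    simp [Matrix.trace, Matrix.mul_apply, Algebra.smul_def]
  rw [h, h, Matrix.map_mul, Matrix.map_mul, Matrix.transpose_mul, Matrix.transpose_mul,
    ← Matrix.mul_assoc, Matrix.trace_mul_comm]
  simp only [Matrix.transpose_map, Matrix.transpose_transpose, Matrix.mul_assoc]

theorem mem_traceAlgebra_of_isHomogeneous [CharZero K] {d : ℕ}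
    {f : MvPolynomial (Fin r × Fin m × Fin m) K} (hf : f.IsHomogeneous d)
    (hinv : ∀ P Q : Matrix (Fin m) (Fin m) K, P * Q = 1 → conjSubst P Q f = f) :
    f ∈ traceAlgebra K (genericMatrix K r m) d := by
  obtain ⟨t, ht, hft⟩ := exists_symmetric_of_isHomogeneous hf
  let T : (Fin d → Fin r) → Matrix (Fin d → Fin m) (Fin d → Fin m) K :=
    fun i => Matrix.of fun a b => t fun k => (i k, a k, b k)
  have hTσ : ∀ (σ : Perm (Fin d)) i a b, T (i ∘ σ) (a ∘ σ) (b ∘ σ) = T i a b :=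
    fun σ i a b => ht σ fun k => (i k, a k, b k)
  have hfT : f = ∑ i : Fin d → Fin r, ∑ a, ∑ b, T i a b •
      tensorMatrix (fun k => genericMatrix K r m (i k)) a b := hft.trans (sum_tuple_eq t)
  have hconj : ∀ P Q : Matrix (Fin m) (Fin m) K, P * Q = 1 → ∀ i,
      (tensorMatrix fun _ => P)ᵀ * T i * (tensorMatrix fun _ => Q)ᵀ = T i := by
    intro P Q hPQ
    let T' : (Fin d → Fin r) → Matrix (Fin d → Fin m) (Fin d → Fin m) K :=
      fun i => (tensorMatrix fun _ => P)ᵀ * T i * (tensorMatrix fun _ => Q)ᵀ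
    have hσ : ∀ (M : Matrix (Fin m) (Fin m) K) (σ : Perm (Fin d)) a b,
        tensorMatrix (fun _ => M) (a ∘ σ) (b ∘ σ) = tensorMatrix (fun _ => M) a b :=
      fun M σ a b => Equiv.prod_comp σ fun k => M (a k) (b k)
    have hT'σ : ∀ (σ : Perm (Fin d)) i a b, T' (i ∘ σ) (a ∘ σ) (b ∘ σ) = T' i a b := by
      intro σ i a b
      let E : (Fin d → Fin m) ≃ (Fin d → Fin m) := Equiv.arrowCongr σ.symm (Equiv.refl _)
      have hE : ∀ c, E c = c ∘ σ := fun c => rfl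
      simp only [T', Matrix.mul_apply, Matrix.transpose_apply]
      rw [← Equiv.sum_comp E]
      refine Finset.sum_congr rfl fun c _ => ?_
      rw [← Equiv.sum_comp E]
      simp only [hE, hσ, hTσ]
    let u : (Fin d → Fin r × Fin m × Fin m) → K := fun p =>
      T' (fun k => (p k).1) (fun k => (p k).2.1) (fun k => (p k).2.2) - t p
    have hu : u = 0 := by
      refine eq_zero_of_symmetric ?_ fun σ p => ?_
      · simp only [u, C_sub, sub_mul, Finset.sum_sub_distrib]
        rw [← hft, sub_eq_zero, sum_tuple_eq]
        conv_rhs => rw [← hinv P Q hPQ, hfT]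
        simp only [map_sum, map_smul]
        refine Finset.sum_congr rfl fun i _ => ?_
        rw [← sum_smul_conj]
        refine Finset.sum_congr rfl fun a _ => Finset.sum_congr rfl fun b _ => ?_
        exact congrArg _ (congrFun (congrFun (conjSubst_tensorMatrix P Q i) a) b).symm
      · exact congrArg₂ _ (hT'σ σ (fun k => (p k).1) (fun k => (p k).2.1) fun k => (p k).2.2)
          (ht σ p)
    intro i
    ext a b
    exact sub_eq_zero.1 (congrFun hu fun k => (i k, a k, b k))
  rw [hfT]
  refine sum_mem fun i _ => ?_
  rw [← tensorTrace_toLin']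
  obtain ⟨z, hz⟩ := exists_asAlgebraHom_eq_toLin' (T i) (by
    intro g
    have h := hconj (g : Matrix (Fin m) (Fin m) K)ᵀ
      ((g⁻¹ : GL (Fin m) K) : Matrix (Fin m) (Fin m) K)ᵀ
      (by rw [← Matrix.transpose_mul, ← Units.val_mul]; simp) i
    have htr : ∀ M : Matrix (Fin m) (Fin m) K,
        (tensorMatrix fun _ : Fin d => Mᵀ)ᵀ = tensorMatrix fun _ => M := fun M => rfl
    rw [htr, htr] at h
    conv_rhs => rw [← h]
    rw [Matrix.mul_assoc _ (tensorMatrix _), ← tensorMatrix_mul, ← Units.val_mul]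
    simp [tensorMatrix_one])
  rw [← hz]
  refine Submodule.span_le (p := Subalgebra.toSubmodule
    (traceAlgebra K (genericMatrix K r m) d)).2 ?_ (tensorTrace_asAlgebraHom_mem_span _ z)
  rintro _ ⟨σ, rfl⟩
  have := permTrace_mem_traceAlgebra (K := K) (genericMatrix K r m) d σ (fun k => [i k])
    (by simp) (Or.inl (by simp))
  simpa using this

theorem isMatrixInvariant_trace (w : List (Fin r)) :
    IsMatrixInvariant K r m (trace (w.map (genericMatrix K r m)).prod) := by
  have heval : ∀ B : Fin r → Matrix (Fin m) (Fin m) K,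
      eval (fun p : Fin r × Fin m × Fin m => B p.1 p.2.1 p.2.2)
        (trace (w.map (genericMatrix K r m)).prod) = trace (w.map B).prod := by
    intro B
    rw [AddMonoidHom.map_trace, ← RingHom.mapMatrix_apply, map_list_prod, List.map_map]
    congr 2
    refine List.map_congr_left fun i _ => Matrix.ext fun a b => ?_
    simp [genericMatrix]
  intro P A
  refine (heval fun i => P.1 * A i * (P⁻¹).1).trans (Eq.trans ?_ (heval A).symm)
  have h1 : (P⁻¹).1 * P.1 = 1 := congrArg Subtype.val (inv_mul_cancel P)
  have h2 : P.1 * (P⁻¹).1 = 1 := congrArg Subtype.val (mul_inv_cancel P)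
  have hprod : (w.map fun i => P.1 * A i * (P⁻¹).1).prod = P.1 * (w.map A).prod * (P⁻¹).1 := by
    clear heval
    induction w with
    | nil => simpa only [List.map_nil, List.prod_nil, Matrix.mul_one] using h2.symm
    | cons i w ih =>
      rw [List.map_cons, List.prod_cons, ih, List.map_cons, List.prod_cons]
      simp only [Matrix.mul_assoc]
      rw [← Matrix.mul_assoc (P⁻¹).1 P.1, h1, Matrix.one_mul]
  rw [hprod, Matrix.trace_mul_comm, ← Matrix.mul_assoc, h1, Matrix.one_mul]

end Invariants

/-- First Fundamental Theorem of matrix invariants (Procesi–Razmyslov–Formanek):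
a polynomial in the entries of `r` generic `m × m` matrices is an `SL_m`-invariant
(for simultaneous conjugation) iff it lies in the `K`-subalgebra generated by the
trace monomials `trace(U_{i₁} ⋯ U_{i_l})` over nonempty words of length `l ≤ m²`. -/
theorem fft_matrix_invariants (K : Type*) [Field K] [IsAlgClosed K] [CharZero K]
    (m r : ℕ) (hm : 1 ≤ m) (hr : 1 ≤ r)
    (f : MvPolynomial (Fin r × Fin m × Fin m) K) :
    IsMatrixInvariant K r m f ↔
      f ∈ Algebra.adjoin K
        {p : MvPolynomial (Fin r × Fin m × Fin m) K |
          ∃ w : List (Fin r), w ≠ [] ∧ w.length ≤ m ^ 2 ∧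
            p = Matrix.trace (w.map (genericMatrix K r m)).prod} := by
  constructor
  · intro hf
    have hsq : ∀ d, traceAlgebra K (genericMatrix K r m) d ≤
        traceAlgebra K (genericMatrix K r m) (m ^ 2) := by
      refine fun d => Algebra.adjoin_le ?_
      rintro _ ⟨w, hw, -, rfl⟩
      simpa using trace_prod_mem_traceAlgebra_sq (K := K) (genericMatrix K r m) w hw
    rw [← sum_homogeneousComponent f]
    refine sum_mem fun d _ => hsq d (mem_traceAlgebra_of_isHomogeneous
      (homogeneousComponent_isHomogeneous d f) fun P Q hPQ => ?_)
    rw [← homogeneousComponent_conjSubst, hf.conjSubst_eq hm hPQ]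
  · intro hf P A
    induction hf using Algebra.adjoin_induction with
    | mem p hp =>
      obtain ⟨w, -, -, rfl⟩ := hp
      exact isMatrixInvariant_trace w P A
    | algebraMap c => simp [algebraMap_eq]
    | add p q _ _ hp hq => rw [map_add, map_add, hp, hq]
    | mul p q _ _ hp hq => rw [map_mul, map_mul, hp, hq]
end

section
/- Let K be a field of characteristic zero, let m ≥ 1 and r ≤ m, and let U₁,…,U_r be generic m×m matrices (matrices of independent commuting indeterminates). Then the polynomials T_σ(U₁,…,U_r), as σ ranges over the symmetric group S_r, are linearly independent over K. (Equivalently, the kernel ideal J(m,r) in the Second Fundamental Theorem of matrix invariants vanishes when r ≤ m.) -/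
open MvPolynomial Matrix

/-- The trace polynomial `T_σ(U₁, …, U_r)` of `r` generic `m × m` matrices
(`U_i` having `(a,b)` entry the variable `X (i, a, b)`), associated to a
permutation `σ ∈ S_r`.  The closed formula
`T_σ(U) = Σ_{j : {1,…,r} → {1,…,m}} ∏_i U_i[j(i), j(σ(i))]`
agrees with the cycle-decomposition definition: if
`σ = (a₁ ⋯ a_{k₁})(b₁ ⋯ b_{k₂})⋯` (1-cycles included), then
`T_σ(U) = trace(U_{a₁} ⋯ U_{a_{k₁}}) · trace(U_{b₁} ⋯ U_{b_{k₂}}) ⋯`. -/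
noncomputable def Tperm (K : Type*) [CommSemiring K] (m r : ℕ) (σ : Equiv.Perm (Fin r)) :
    MvPolynomial (Fin r × Fin m × Fin m) K :=
  ∑ j : Fin r → Fin m, ∏ i : Fin r, MvPolynomial.X (i, j i, j (σ i))

/-- Evaluating `U_i` at the matrix unit `E_{c(i), c(τ(i))}`, for an injection `c`, separates
`T_τ` from the other trace polynomials. -/
theorem eval_Tperm_matrixUnit (K : Type*) [CommSemiring K] {m r : ℕ} (c : Fin r ↪ Fin m)
    (σ τ : Equiv.Perm (Fin r)) :
    eval (fun p : Fin r × Fin m × Fin m => if p.2 = (c p.1, c (τ p.1)) then (1 : K) else 0)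
      (Tperm K m r σ) = if σ = τ then 1 else 0 := by
  simp only [Tperm, map_sum, map_prod, eval_X, Finset.prod_ite_zero, Finset.prod_const_one,
    Finset.mem_univ, true_imp_iff, Prod.mk.injEq]
  split_ifs with h
  · subst h
    rw [Finset.sum_eq_single (c : Fin r → Fin m)]
    · simp
    · intro j _ hj
      exact if_neg fun hall => hj (funext fun i => (hall i).1)
    · simp
  · refine Finset.sum_eq_zero fun j _ => if_neg fun hall => h (Equiv.ext fun i => c.injective ?_)
    rw [← (hall (σ i)).1, (hall i).2]

/-- For `r ≤ m`, the trace polynomials `T_σ(U₁, …, U_r)` of `r` generic `m × m`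
matrices, as `σ` ranges over the symmetric group `S_r`, are linearly independent
over a field of characteristic zero (equivalently, the kernel ideal `J(m,r)` of
the Second Fundamental Theorem of matrix invariants vanishes for `r ≤ m`). -/
theorem Tperm_linearIndependent (K : Type*) [Field K] [CharZero K]
    (m r : ℕ) (hm : 1 ≤ m) (hr : 1 ≤ r) (hrm : r ≤ m) :
    LinearIndependent K (fun σ : Equiv.Perm (Fin r) => Tperm K m r σ) := by
  rw [Fintype.linearIndependent_iff]
  intro g hg τ
  have h := congrArg (eval fun p : Fin r × Fin m × Fin m =>
    if p.2 = (Fin.castLEEmb hrm p.1, Fin.castLEEmb hrm (τ p.1)) then (1 : K) else 0) hg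
  simpa only [map_sum, smul_eval, eval_Tperm_matrixUnit, mul_ite, mul_one, mul_zero,
    Finset.sum_ite_eq', Finset.mem_univ, if_true, map_zero] using h
end

section
/- Let K be a field of characteristic zero and let U₁,…,U_{m+1} be m×m matrices over K. Then Σ_{σ ∈ S_{m+1}} sign(σ) · T_σ(U₁,…,U_{m+1}) = 0. (The fundamental trace identity, a consequence of the Cayley–Hamilton theorem.) -/
open Matrix

/-- The trace function `T_σ(U₁, …, U_r)` of matrices `U₁, …, U_r`, for a
permutation `σ ∈ S_r`.  The closed formula
`T_σ(U) = Σ_{j : {1,…,r} → {1,…,m}} ∏_i U_i[j(i), j(σ(i))]`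
agrees with the cycle-decomposition definition: if
`σ = (a₁ ⋯ a_{k₁})(b₁ ⋯ b_{k₂})⋯` (1-cycles included), then
`T_σ(U) = trace(U_{a₁} ⋯ U_{a_{k₁}}) · trace(U_{b₁} ⋯ U_{b_{k₂}}) ⋯`. -/
def TpermEval (K : Type*) [CommSemiring K] (m r : ℕ)
    (U : Fin r → Matrix (Fin m) (Fin m) K) (σ : Equiv.Perm (Fin r)) : K :=
  ∑ j : Fin r → Fin m, ∏ i : Fin r, U i (j i) (j (σ i))

/-- The fundamental trace identity (a consequence of the Cayley–Hamilton theorem):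
for `m × m` matrices `U₁, …, U_{m+1}` over a field of characteristic zero,
`Σ_{σ ∈ S_{m+1}} sign(σ) · T_σ(U₁, …, U_{m+1}) = 0`. -/
theorem fundamental_trace_identity (K : Type*) [Field K] [CharZero K] (m : ℕ)
    (U : Fin (m + 1) → Matrix (Fin m) (Fin m) K) :
    ∑ σ : Equiv.Perm (Fin (m + 1)),
        ((Equiv.Perm.sign σ : ℤ) : K) * TpermEval K m (m + 1) U σ = 0 := by
  simp only [TpermEval, Finset.mul_sum]
  rw [Finset.sum_comm]
  refine Finset.sum_eq_zero fun j _ => ?_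
  obtain ⟨a, b, hab, hj⟩ := Fintype.exists_ne_map_eq_of_card_lt j (by simp)
  have hdet : (Matrix.of fun k i => U i (j i) (j k)).det = 0 :=
    Matrix.det_zero_of_row_eq hab (by ext i; simp [hj])
  simpa only [Matrix.det_apply', Matrix.of_apply] using hdet
end

section
/- Let K be an algebraically closed field, t ≥ 1, let I be a homogeneous ideal of the polynomial ring K[z₁,…,z_t], and let S be a finite set of non-constant homogeneous polynomials in K[z₁,…,z_t]. If the only point of K^t at which all elements of I and all elements of S vanish is the origin, then the quotient ring K[z₁,…,z_t]/I is integral over its K-subalgebra generated by the images of the elements of S. -/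
open MvPolynomial

namespace MvPolynomial

attribute [local instance] MvPolynomial.gradedAlgebra

/-- If the homogeneous ideal `I` together with a set `S` of homogeneous polynomials of positive
degree contains a power of the irrelevant ideal, then the quotient by `I` is a finite module over
the subalgebra generated by the image of `S`. -/
theorem finite_quotient_of_pow_idealOfVars_le {σ R : Type*} [Finite σ] [CommRing R]
    {I : Ideal (MvPolynomial σ R)} (hI : I.IsHomogeneous (homogeneousSubmodule σ R))
    {S : Set (MvPolynomial σ R)} (hS : ∀ s ∈ S, ∃ d : ℕ, 0 < d ∧ s.IsHomogeneous d)
    {N : ℕ} (hN : idealOfVars σ R ^ N ≤ I ⊔ Ideal.span S) :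
    Module.Finite (Algebra.adjoin R (Ideal.Quotient.mk I '' S)) (MvPolynomial σ R ⧸ I) := by
  set B := Algebra.adjoin R (Ideal.Quotient.mk I '' S)
  let T : Set (MvPolynomial σ R ⧸ I) :=
    (fun m ↦ Ideal.Quotient.mk I (monomial m 1)) '' {m : σ →₀ ℕ | m.degree ≤ N}
  have hT : T.Finite := (Finsupp.finite_of_degree_le N).image _
  let M : Submodule B (MvPolynomial σ R ⧸ I) := Submodule.span B T
  have smul_mem (s) (hs : s ∈ S) (f : MvPolynomial σ R) (hf : Ideal.Quotient.mk I f ∈ M) :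
      Ideal.Quotient.mk I (f * s) ∈ M := by
    have := M.smul_mem (⟨_, Algebra.subset_adjoin ⟨s, hs, rfl⟩⟩ : B) hf
    rwa [Subalgebra.smul_def, smul_eq_mul, ← map_mul, mul_comm] at this
  have homogeneous_mem (n : ℕ) :
      ∀ f : MvPolynomial σ R, f.IsHomogeneous n → Ideal.Quotient.mk I f ∈ M := by
    induction n using Nat.strong_induction_on with
    | _ n ih =>
    intro f hf
    have degree_eq (m : σ →₀ ℕ) (hm : coeff m f ≠ 0) : m.degree = n := by
      rw [Finsupp.degree_eq_weight_one]
      exact hf hm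
    rcases le_or_gt n N with hn | hn
    · rw [f.as_sum, map_sum]
      refine sum_mem fun m hm ↦ ?_
      have hmT : Ideal.Quotient.mk I (monomial m 1) ∈ M :=
        Submodule.subset_span ⟨m, (degree_eq m (mem_support_iff.mp hm)).trans_le hn, rfl⟩
      have := M.smul_mem (⟨_, B.algebraMap_mem (coeff m f)⟩ : B) hmT
      rw [Subalgebra.smul_def, smul_eq_mul] at this
      dsimp only at this
      rwa [← Ideal.Quotient.mk_algebraMap, ← map_mul, algebraMap_eq, C_mul_monomial,
        mul_one] at this
    · have hfJ : f ∈ I ⊔ Ideal.span S := by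
        refine hN ((mem_pow_idealOfVars_iff' ..).mpr fun m hm ↦ ?_)
        by_contra h
        have := degree_eq m h
        omega
      obtain ⟨g, hg, h, hh, rfl⟩ := Submodule.mem_sup.mp hfJ
      have component_mem : ∀ a, Ideal.Quotient.mk I (homogeneousComponent n (a * h)) ∈ M := by
        clear hf hfJ degree_eq
        induction hh using Submodule.span_induction with
        | zero => simp
        | add x y _ _ hx hy =>
          intro a
          rw [mul_add, map_add, map_add]
          exact add_mem (hx a) (hy a)
        | smul b x _ hx =>
          intro a
          rw [smul_eq_mul, ← mul_assoc]
          exact hx _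
        | mem s hs =>
          intro a
          obtain ⟨d, hd, hsd⟩ := hS s hs
          rw [← sum_homogeneousComponent a, Finset.sum_mul, map_sum, map_sum]
          refine sum_mem fun i _ ↦ ?_
          have hi := homogeneousComponent_isHomogeneous i a
          rw [homogeneousComponent_of_mem (hi.mul hsd)]
          split_ifs with hid
          · exact smul_mem s hs _ (ih i (by omega) _ hi)
          · simp
      have hfn := homogeneousComponent_of_mem (m := n) hf
      rw [if_pos rfl] at hfn
      rw [← hfn, map_add, map_add,
        Ideal.Quotient.eq_zero_iff_mem.mpr (homogeneousComponent_mem_of_mem hI hg n), zero_add]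
      simpa using component_mem 1
  refine ⟨Submodule.fg_def.mpr ⟨T, hT, ?_⟩⟩
  refine eq_top_iff.mpr fun x _ ↦ ?_
  obtain ⟨f, rfl⟩ := Ideal.Quotient.mk_surjective x
  rw [← sum_homogeneousComponent f, map_sum]
  exact sum_mem fun i _ ↦ homogeneous_mem i _ (homogeneousComponent_isHomogeneous i f)

end MvPolynomial

/-- Let `K` be an algebraically closed field, `I` a homogeneous ideal of
`K[z₁, …, z_t]` (an ideal generated by homogeneous polynomials) and `S` a finite
set of non-constant homogeneous polynomials.  If the only common zero in `K^t` of
all elements of `I` and of `S` is the origin, then `K[z₁, …, z_t]/I` is integral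
over its `K`-subalgebra generated by the images of the elements of `S`. -/
theorem quotient_isIntegral_of_common_zero_eq_origin
    (K : Type*) [Field K] [IsAlgClosed K] (t : ℕ) (ht : 1 ≤ t)
    (I : Ideal (MvPolynomial (Fin t) K))
    (hI : ∃ G : Set (MvPolynomial (Fin t) K),
        (∀ g ∈ G, ∃ d : ℕ, g.IsHomogeneous d) ∧ I = Ideal.span G)
    (S : Finset (MvPolynomial (Fin t) K))
    (hS : ∀ s ∈ S, ∃ d : ℕ, 0 < d ∧ MvPolynomial.IsHomogeneous s d)
    (hzero : ∀ p : Fin t → K,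
        (∀ g ∈ I, MvPolynomial.eval p g = 0) → (∀ s ∈ S, MvPolynomial.eval p s = 0) →
        p = 0) :
    Algebra.IsIntegral
      (Algebra.adjoin K (⇑(Ideal.Quotient.mk I) '' (S : Set (MvPolynomial (Fin t) K))))
      (MvPolynomial (Fin t) K ⧸ I) := by
  obtain ⟨G, hG, rfl⟩ := hI
  let _ : GradedAlgebra (homogeneousSubmodule (Fin t) K) := gradedAlgebra
  have hI : (Ideal.span G).IsHomogeneous (homogeneousSubmodule (Fin t) K) :=
    Ideal.homogeneous_span _ _ hG
  have hrad : idealOfVars (Fin t) K ≤ (Ideal.span G ⊔ Ideal.span (S : Set _)).radical := by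
    rw [← vanishingIdeal_zeroLocus_eq_radical (K := K), idealOfVars, Ideal.span_le]
    rintro _ ⟨i, rfl⟩ p hp
    have hp0 : p = 0 := hzero p
      (fun g hg ↦ by simpa [aeval_eq_eval] using hp g (Ideal.mem_sup_left hg))
      (fun s hs ↦ by
        simpa [aeval_eq_eval] using hp s (Ideal.mem_sup_right (Ideal.subset_span hs)))
    simp [hp0]
  obtain ⟨N, hN⟩ := Ideal.exists_pow_le_of_le_radical_of_fg hrad (idealOfVars_fg _ _)
  have := finite_quotient_of_pow_idealOfVars_le hI hS hN
  exact Algebra.IsIntegral.of_finite _ _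
end

section
/- Let K be a field, t ≥ 1, let I be a homogeneous ideal of the polynomial ring K[z₁,…,z_t], and let S be a set of non-constant homogeneous polynomials in K[z₁,…,z_t]. If the quotient ring K[z₁,…,z_t]/I is integral over its K-subalgebra generated by the images of the elements of S, then every point p ∈ K^t at which all elements of I and all elements of S vanish is the origin. -/
open MvPolynomial

/-- Restricting a homogeneous polynomial of degree `d` to the line spanned by `p`. -/
theorem MvPolynomial.IsHomogeneous.aeval_C_mul_X {σ K : Type*} [CommRing K]
    {f : MvPolynomial σ K} {d : ℕ} (hf : f.IsHomogeneous d) (p : σ → K) :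
    MvPolynomial.aeval (fun i => Polynomial.C (p i) * Polynomial.X) f =
      Polynomial.C (MvPolynomial.eval p f) * Polynomial.X ^ d := by
  rw [aeval_def, eval₂_eq, eval_eq, map_sum, Finset.sum_mul]
  refine Finset.sum_congr rfl fun m hm => ?_
  have hdeg : ∑ i ∈ m.support, m i = d := by
    rw [← hf (mem_support_iff.1 hm), Finsupp.weight_apply]
    simp [Finsupp.sum]
  simp [mul_pow, Finset.prod_mul_distrib, Finset.prod_pow_eq_pow_sum, hdeg, mul_assoc]

/-- Let `K` be a field, `I` a homogeneous ideal of `K[z₁, …, z_t]` (an ideal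
generated by homogeneous polynomials) and `S` a set of non-constant homogeneous
polynomials.  If `K[z₁, …, z_t]/I` is integral over its `K`-subalgebra generated
by the images of the elements of `S`, then every common zero in `K^t` of all the
elements of `I` and of `S` is the origin. -/
theorem common_zero_eq_origin_of_quotient_isIntegral
    (K : Type*) [Field K] (t : ℕ) (ht : 1 ≤ t)
    (I : Ideal (MvPolynomial (Fin t) K))
    (hI : ∃ G : Set (MvPolynomial (Fin t) K),
        (∀ g ∈ G, ∃ d : ℕ, g.IsHomogeneous d) ∧ I = Ideal.span G)
    (S : Set (MvPolynomial (Fin t) K))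
    (hS : ∀ s ∈ S, ∃ d : ℕ, 0 < d ∧ MvPolynomial.IsHomogeneous s d)
    (hint : Algebra.IsIntegral
      (Algebra.adjoin K (⇑(Ideal.Quotient.mk I) '' S))
      (MvPolynomial (Fin t) K ⧸ I))
    (p : Fin t → K)
    (hpI : ∀ g ∈ I, MvPolynomial.eval p g = 0)
    (hpS : ∀ s ∈ S, MvPolynomial.eval p s = 0) :
    p = 0 := by
  obtain ⟨G, hG, rfl⟩ := hI
  let line : MvPolynomial (Fin t) K →ₐ[K] Polynomial K :=
    aeval fun i => Polynomial.C (p i) * Polynomial.X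
  have line_eq_zero {f : MvPolynomial (Fin t) K} {d : ℕ} (hf : f.IsHomogeneous d)
      (hp : eval p f = 0) : line f = 0 := by
    simp [line, hf.aeval_C_mul_X, hp]
  have hline : ∀ f ∈ Ideal.span G, line f = 0 := by
    suffices Ideal.span G ≤ RingHom.ker line from fun f hf => this hf
    refine Ideal.span_le.2 fun g hg => ?_
    obtain ⟨d, hd⟩ := hG g hg
    exact line_eq_zero hd (hpI g (Ideal.subset_span hg))
  let ψ : MvPolynomial (Fin t) K ⧸ Ideal.span G →ₐ[K] Polynomial K :=
    Ideal.Quotient.liftₐ _ line hline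
  have hadjoin : Algebra.adjoin K (⇑(Ideal.Quotient.mk (Ideal.span G)) '' S) ≤
      AlgHom.equalizer (((Algebra.ofId K (Polynomial K)).comp
        (Polynomial.aeval (0 : K))).comp ψ) ψ := by
    refine Algebra.adjoin_le ?_
    rintro _ ⟨s, hs, rfl⟩
    obtain ⟨d, -, hd⟩ := hS s hs
    have hψ : ψ (Ideal.Quotient.mk _ s) = 0 := line_eq_zero hd (hpS s hs)
    simp [hψ]
  funext i
  by_contra hi
  have hint_line : IsIntegral K (ψ (Ideal.Quotient.mk _ (X i))) :=
    (hint.isIntegral _).map_of_comp_eq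
      (((Polynomial.aeval (0 : K)).comp ψ).comp (Subalgebra.val _)).toRingHom
      ψ.toRingHom (RingHom.ext fun a => hadjoin a.2)
  have hψX : ψ (Ideal.Quotient.mk _ (X i)) = Polynomial.C (p i) * Polynomial.X :=
    aeval_X _ i
  have hX : IsIntegral K (Polynomial.X : Polynomial K) := by
    have h := hint_line.smul (p i)⁻¹
    rwa [hψX, ← Polynomial.smul_eq_C_mul, inv_smul_smul₀ hi] at h
  exact Polynomial.transcendental_X K hX.isAlgebraic
end

section
/- Let K be a field of characteristic zero and let k, e, l, r be positive integers with 2^l > k·e. Let f = Σ_{i=1}^{k} ℓ_i^{e_i} ∈ K[x₁,…,x_r], where each ℓ_i is a (possibly non-homogeneous) polynomial of degree at most 1 and each e_i ≤ e. If f is not the zero polynomial, then there exists a point b ∈ K^r whose coordinates all lie in {0,1,…,e} (the images of these natural numbers in K) and at most l of whose coordinates are nonzero, such that f(b) ≠ 0. -/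
open MvPolynomial

namespace MvPolynomial

variable {σ K : Type*} [Field K]

/-- The partial derivatives of a polynomial of degree at most one are constants. -/
theorem pderiv_eq_C_of_totalDegree_le_one {p : MvPolynomial σ K} (hp : p.totalDegree ≤ 1)
    (i : σ) : pderiv i p = C (coeff (Finsupp.single i 1) p) := by
  classical
  ext m
  rw [coeff_pderiv, coeff_C]
  split_ifs with hm
  · simp [← hm]
  · have hdeg : p.totalDegree < (m + Finsupp.single i 1).degree := by
      have hpos : m.degree ≠ 0 := fun h => hm ((Finsupp.degree_eq_zero_iff m).1 h).symm
      rw [map_add, Finsupp.degree_single]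
      omega
    rw [coeff_eq_zero_of_totalDegree_lt hdeg, zero_mul]

/-- A subspace stable under partial derivatives is stable under all higher derivatives: it
contains, up to nonzero rescaling of coefficients, every backward shift of its elements. -/
theorem exists_mem_coeff_eq_mul_coeff_add [CharZero K] {V : Submodule K (MvPolynomial σ K)}
    (hV : ∀ i, ∀ p ∈ V, pderiv i p ∈ V) {f : MvPolynomial σ K} (hf : f ∈ V) (b : σ →₀ ℕ) :
    ∃ g ∈ V, ∀ c, ∃ u : K, u ≠ 0 ∧ coeff c g = u * coeff (c + b) f := by
  induction b using Finsupp.induction_linear generalizing f with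
  | zero => exact ⟨f, hf, fun c => ⟨1, one_ne_zero, by simp⟩⟩
  | add b₁ b₂ ih₁ ih₂ =>
    obtain ⟨g₁, hg₁, h₁⟩ := ih₁ hf
    obtain ⟨g₂, hg₂, h₂⟩ := ih₂ hg₁
    refine ⟨g₂, hg₂, fun c => ?_⟩
    obtain ⟨u₂, hu₂, e₂⟩ := h₂ c
    obtain ⟨u₁, hu₁, e₁⟩ := h₁ (c + b₂)
    refine ⟨u₂ * u₁, mul_ne_zero hu₂ hu₁, ?_⟩
    rw [e₂, e₁, mul_assoc, add_assoc, add_comm b₂]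
  | single i n =>
    induction n generalizing f with
    | zero => exact ⟨f, hf, fun c => ⟨1, one_ne_zero, by simp⟩⟩
    | succ n ih =>
      obtain ⟨g, hg, h⟩ := ih (hV i f hf)
      refine ⟨g, hg, fun c => ?_⟩
      obtain ⟨u, hu, e⟩ := h c
      refine ⟨u * ((c + Finsupp.single i n) i + 1), mul_ne_zero hu (Nat.cast_add_one_ne_zero _), ?_⟩
      rw [e, coeff_pderiv, add_assoc, ← Finsupp.single_add]
      ring

/-- The number of divisors of the leading monomial of `f` is at most the dimension of any
subspace containing `f` and stable under partial derivatives. -/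
theorem card_Iic_degree_le_finrank [CharZero K] [DecidableEq σ] (m : MonomialOrder σ)
    {V : Submodule K (MvPolynomial σ K)} [FiniteDimensional K V]
    (hV : ∀ i, ∀ p ∈ V, pderiv i p ∈ V) {f : MvPolynomial σ K} (hf : f ∈ V) (hf0 : f ≠ 0) :
    (Finset.Iic (m.degree f)).card ≤ Module.finrank K V := by
  classical
  choose g hg u hu hgu using exists_mem_coeff_eq_mul_coeff_add hV hf
  have hli : LinearIndependent K
      (fun b : Finset.Iic (m.degree f) => (⟨g b, hg b⟩ : V)) := by
    rw [linearIndependent_iff']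
    intro s w hw
    by_contra! hne
    obtain ⟨i₀, hi₀, hwi₀⟩ := hne
    obtain ⟨i, hi, hmin⟩ := Finset.exists_min_image (s.filter (w · ≠ 0))
      (fun b => m.toSyn b.1) ⟨i₀, by simp [hi₀, hwi₀]⟩
    rw [Finset.mem_filter] at hi
    have hle : i.1 ≤ m.degree f := Finset.mem_Iic.1 i.2
    have hcoeff : ∑ b ∈ s, w b * coeff (m.degree f - i.1) (g b) = 0 := by
      have := congrArg (fun p : V => coeff (m.degree f - i.1) (p : MvPolynomial σ K)) hw
      simpa [coeff_sum, coeff_smul] using this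
    rw [Finset.sum_eq_single_of_mem i hi.1, hgu, tsub_add_cancel_of_le hle] at hcoeff
    · exact mul_ne_zero hi.2 (mul_ne_zero (hu _ _) (m.coeff_degree_ne_zero_iff.2 hf0)) hcoeff
    · intro b hb hbi
      by_cases hwb : w b = 0
      · rw [hwb, zero_mul]
      · have hlt : m.toSyn i.1 < m.toSyn b.1 :=
          lt_of_le_of_ne (hmin b (by simp [hb, hwb])) fun h =>
            hbi (Subtype.ext (m.toSyn.injective h)).symm
        rw [hgu, m.coeff_eq_zero_of_lt, mul_zero, mul_zero]
        calc m.toSyn (m.degree f) = m.toSyn (m.degree f - i.1) + m.toSyn i.1 := by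
              rw [← map_add, tsub_add_cancel_of_le hle]
          _ < m.toSyn (m.degree f - i.1) + m.toSyn b.1 := by gcongr
          _ = m.toSyn (m.degree f - i.1 + b.1) := (map_add _ _ _).symm
  simpa using hli.fintype_card_le_finrank

/-- The span of `1` and the powers `L i ^ n` with `1 ≤ n ≤ e`. -/
noncomputable def powersSpan {k : ℕ} (L : Fin k → MvPolynomial σ K) (e : ℕ) :
    Submodule K (MvPolynomial σ K) :=
  Submodule.span K
    (Set.range fun t : Option (Fin k × Fin e) => t.elim 1 fun s => L s.1 ^ (s.2 + 1 : ℕ))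

theorem pderiv_mem_powersSpan {k e : ℕ} {L : Fin k → MvPolynomial σ K}
    (hdeg : ∀ i, (L i).totalDegree ≤ 1) (i : σ) :
    ∀ p ∈ powersSpan L e, pderiv i p ∈ powersSpan L e := by
  intro p hp
  induction hp using Submodule.span_induction with
  | zero => simp
  | add p q _ _ hp hq => rw [map_add]; exact add_mem hp hq
  | smul a p _ hp => rw [Derivation.map_smul]; exact Submodule.smul_mem _ _ hp
  | mem p hp =>
    obtain ⟨_ | ⟨j, n, hn⟩, rfl⟩ := hp
    · simp
    · have hpow : L j ^ n ∈ powersSpan L e := by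
        cases n with
        | zero => exact Submodule.subset_span ⟨none, by simp⟩
        | succ n => exact Submodule.subset_span ⟨some (j, ⟨n, by omega⟩), rfl⟩
      have hderiv : pderiv i (L j ^ (n + 1)) =
          (((n + 1 : ℕ) : K) * coeff (Finsupp.single i 1) (L j)) • L j ^ n := by
        rw [pderiv_pow, pderiv_eq_C_of_totalDegree_le_one (hdeg j), smul_eq_C_mul, map_mul,
          map_natCast, Nat.add_sub_cancel]
        ring
      simpa only [Option.elim_some, hderiv] using Submodule.smul_mem _ _ hpow

/-- The leading monomial of a nonzero sum of `k` powers of affine linear forms with exponents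
in `{1, …, e}` has at most `k * e + 1` divisors. -/
theorem card_Iic_degree_sum_pow_le [CharZero K] [DecidableEq σ] (m : MonomialOrder σ) {k e : ℕ}
    {L : Fin k → MvPolynomial σ K} (hdeg : ∀ i, (L i).totalDegree ≤ 1)
    {E : Fin k → ℕ} (hE : ∀ i, 0 < E i ∧ E i ≤ e) (hf : (∑ i, L i ^ E i) ≠ 0) :
    (Finset.Iic (m.degree (∑ i, L i ^ E i))).card ≤ k * e + 1 := by
  have hmem : ∑ i, L i ^ E i ∈ powersSpan L e := by
    refine Submodule.sum_mem _ fun i _ => Submodule.subset_span ?_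
    have := hE i
    refine ⟨some (i, ⟨E i - 1, by omega⟩), ?_⟩
    simp [Nat.sub_add_cancel this.1]
  have : FiniteDimensional K (powersSpan L e) :=
    FiniteDimensional.span_of_finite K (Set.finite_range _)
  refine (card_Iic_degree_le_finrank m (pderiv_mem_powersSpan hdeg) hmem hf).trans ?_
  refine (finrank_range_le_card _).trans ?_
  simp

end MvPolynomial

theorem Finsupp.two_pow_card_support_le_card_Iic {σ : Type*} [DecidableEq σ] (a : σ →₀ ℕ) :
    2 ^ a.support.card ≤ (Finset.Iic a).card := by
  rw [Finsupp.card_Iic]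
  refine Finset.pow_card_le_prod _ _ _ fun i hi => ?_
  have := Finsupp.mem_support_iff.1 hi
  rw [Nat.card_Iic]
  omega

/-- Hitting set for diagonal depth three circuits: if `2^l > k·e` and
`f = Σ_{i=1}^{k} ℓ_i^{e_i}` (with affine linear `ℓ_i` and `0 < e_i ≤ e`) is a
nonzero polynomial, then `f` is nonzero at some point `b ∈ K^r` whose coordinates
are (images of) natural numbers in `{0, 1, …, e}`, at most `l` of which are
nonzero. -/
theorem diagonal_depth_three_hitting_set (K : Type*) [Field K] [CharZero K]
    (k e l r : ℕ) (hk : 0 < k) (he : 0 < e) (hl : 0 < l) (hr : 0 < r)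
    (hle : k * e < 2 ^ l)
    (L : Fin k → MvPolynomial (Fin r) K) (hdeg : ∀ i, (L i).totalDegree ≤ 1)
    (E : Fin k → ℕ) (hE : ∀ i, 0 < E i ∧ E i ≤ e)
    (hf : (∑ i : Fin k, L i ^ E i) ≠ 0) :
    ∃ b : Fin r → K,
      (∀ i : Fin r, ∃ c : ℕ, c ≤ e ∧ b i = (c : K)) ∧
      (∃ J : Finset (Fin r), J.card ≤ l ∧ ∀ i ∉ J, b i = 0) ∧
      MvPolynomial.eval b (∑ i : Fin k, L i ^ E i) ≠ 0 := by
  classical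
  set f := ∑ i : Fin k, L i ^ E i
  set a := MonomialOrder.degLex.degree f
  have hcard : a.support.card ≤ l := by
    have h1 := card_Iic_degree_sum_pow_le MonomialOrder.degLex hdeg hE hf
    exact (Nat.pow_le_pow_iff_right one_lt_two).1
      ((a.two_pow_card_support_le_card_Iic.trans h1).trans hle)
  have hftotal : f.totalDegree ≤ e := by
    refine totalDegree_finsetSum_le fun i _ => (totalDegree_pow _ _).trans ?_
    calc E i * (L i).totalDegree ≤ e * 1 := Nat.mul_le_mul (hE i).2 (hdeg i)
      _ = e := mul_one e
  have hae (i : Fin r) : a i ≤ e :=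
    (Finsupp.le_degree i a).trans ((degree_degLexDegree (f := f)).trans_le hftotal)
  obtain ⟨b, hbS, hb⟩ := combinatorial_nullstellensatz_exists_eval_nonzero f a
    (MonomialOrder.degLex.coeff_degree_ne_zero_iff.2 hf) degree_degLexDegree.symm
    (fun i => if i ∈ a.support then (Finset.range (e + 1)).image (Nat.cast : ℕ → K) else {0})
    (fun i => by
      split_ifs with hi
      · rw [Finset.card_image_of_injective _ Nat.cast_injective, Finset.card_range]
        exact Nat.lt_succ_of_le (hae i)
      · simp [Finsupp.notMem_support_iff.1 hi])
  refine ⟨b, fun i => ?_, ⟨a.support, hcard, fun i hi => ?_⟩, hb⟩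
  · have hi := hbS i
    split_ifs at hi
    · obtain ⟨c, hc, hcb⟩ := Finset.mem_image.1 hi
      exact ⟨c, Nat.lt_succ_iff.1 (Finset.mem_range.1 hc), hcb.symm⟩
    · exact ⟨0, Nat.zero_le e, by simpa using hi⟩
  · simpa only [if_neg hi, Finset.mem_singleton] using hbS i
end

section
/- Let K be an algebraically closed field of characteristic zero and m, r ≥ 1. Let W be the set of all nonempty words α = (i₁,…,i_l) with entries in {1,…,r} of length l ≤ m², let N = |W|, and let π : (M_m(K))^r → K^N be the map sending a tuple A = (A₁,…,A_r) to the tuple (trace(A_{i₁}⋯A_{i_l}))_{α ∈ W}. Then the image of π is Zariski closed in K^N: there exists a set Q of polynomials on K^N whose common zero set equals the image of π. (The instance of Mumford's theorem that the categorical quotient map for matrix invariants has closed image.) -/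
open MvPolynomial Matrix

/-- Nonempty words with entries in `{1, …, r}` of length at most `m²`. -/
abbrev MatrixTraceWord (r m : ℕ) := {w : List (Fin r) // w ≠ [] ∧ w.length ≤ m ^ 2}

/-- The map `π` sending an `r`-tuple `A` of `m × m` matrices to the tuple of all
trace monomials `trace(A_{i₁} ⋯ A_{i_l})` over nonempty words of length `l ≤ m²`. -/
def traceMonomialMap (K : Type*) [Field K] (r m : ℕ)
    (A : Fin r → Matrix (Fin m) (Fin m) K) : MatrixTraceWord r m → K :=
  fun w => Matrix.trace ((w : List (Fin r)).map A).prod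

section NagataHigman

variable {K : Type*} [Field K]

lemma mem_of_forall_sum_pow_smul_mem [CharZero K] {V : Type*} [AddCommGroup V] [Module K V]
    (W : Submodule K V) {N : ℕ} (c : ℕ → V)
    (h : ∀ x : K, ∑ i ∈ Finset.range N, x ^ i • c i ∈ W) {k : ℕ} (hk : k < N) : c k ∈ W := by
  let v : Fin N → K := fun i => (i : ℕ)
  have hdet : IsUnit (Matrix.vandermonde v).det :=
    (Matrix.det_vandermonde_ne_zero_iff.mpr
      (Nat.cast_injective.comp Fin.val_injective)).isUnit
  have key : c k = ∑ j : Fin N, (Matrix.vandermonde v)⁻¹ ⟨k, hk⟩ j •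
      ∑ i : Fin N, (v j) ^ (i : ℕ) • c i := by
    simp_rw [Finset.smul_sum, smul_smul]
    rw [Finset.sum_comm]
    simp_rw [← Finset.sum_smul]
    have hinv := Matrix.nonsing_inv_mul (Matrix.vandermonde v) hdet
    have h1 : ∀ i : Fin N, ∑ j, (Matrix.vandermonde v)⁻¹ ⟨k, hk⟩ j * v j ^ (i : ℕ)
        = (1 : Matrix (Fin N) (Fin N) K) ⟨k, hk⟩ i := fun i => by
      rw [← hinv]; rfl
    simp_rw [h1, Matrix.one_apply, ite_smul, one_smul, zero_smul]
    simp
  rw [key]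
  refine W.sum_mem fun j _ => W.smul_mem _ ?_
  rw [Fin.sum_univ_eq_sum_range (fun i => v j ^ i • c i)]
  exact h _

variable {M : Type*} [Ring M] [Algebra K M]

lemma exists_add_smul_pow_expansion (a b : M) (n : ℕ) :
    ∃ c : ℕ → M, c 0 = a ^ n ∧ c 1 = ∑ i ∈ Finset.range n, a ^ i * b * a ^ (n - 1 - i) ∧
      (∀ i, n < i → c i = 0) ∧
      ∀ x : K, (a + x • b) ^ n = ∑ i ∈ Finset.range (n + 1), x ^ i • c i := by
  induction n with
  | zero => exact ⟨fun i => if i = 0 then 1 else 0, by simp, by simp,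
      fun i hi => by simp; omega, fun x => by simp⟩
  | succ n ih =>
    obtain ⟨c, h0, h1, hz, hc⟩ := ih
    refine ⟨fun i => c i * a + (if i = 0 then 0 else c (i - 1) * b), ?_, ?_, ?_, ?_⟩
    · simp [h0, pow_succ]
    · simp only [one_ne_zero, if_false, Nat.sub_self, h0, h1]
      rw [Finset.sum_range_succ, Finset.sum_mul]
      congr 1
      · refine Finset.sum_congr rfl fun i hi => ?_
        have : n + 1 - 1 - i = (n - 1 - i) + 1 := by have := Finset.mem_range.mp hi; omega
        rw [this, pow_succ]; simp only [mul_assoc]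
      · simp
    · intro i hi
      simp [hz i (by omega), hz (i - 1) (by omega)]
    · intro x
      rw [pow_succ, hc x, mul_add]
      simp_rw [smul_add, Finset.sum_add_distrib]
      congr 1
      · rw [Finset.sum_range_succ _ (n + 1), hz (n + 1) (by omega)]
        simp [Finset.sum_mul]
      · rw [Finset.sum_range_succ' _ (n + 1)]
        simp only [Finset.sum_mul, Finset.smul_sum, smul_mul_assoc, mul_smul_comm, pow_succ',
          smul_smul]
        simp

lemma sum_pow_mul_mul_pow_mem [CharZero K] {S I : Submodule K M} {n : ℕ} (hn : ∀ a ∈ S, a ^ (n + 1) ∈ I)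
    {a b : M} (ha : a ∈ S) (hb : b ∈ S) :
    ∑ i ∈ Finset.range (n + 1), a ^ i * b * a ^ (n - i) ∈ I := by
  obtain ⟨c, -, h1, -, hc⟩ := exists_add_smul_pow_expansion (K := K) a b (n + 1)
  have := mem_of_forall_sum_pow_smul_mem I c (N := n + 2)
    (fun x => by rw [← hc x]; exact hn _ (S.add_mem ha (S.smul_mem _ hb))) (k := 1) (by omega)
  simpa [h1] using this

lemma pow_mem_of_mul_le {S : Submodule K M} (hS : S * S ≤ S) {a : M} (ha : a ∈ S) (n : ℕ) :
    a ^ (n + 1) ∈ S := by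
  induction n with
  | zero => simpa
  | succ n ih => rw [pow_succ]; exact hS (Submodule.mul_mem_mul ih ha)

/-- Higman's identity: in a nil algebra of index `n + 1`, `aⁿ c bⁿ = 0`. -/
lemma pow_mul_mul_pow_mem [CharZero K] {S I : Submodule K M} (hS : S * S ≤ S)
    (hSI : S * I ≤ I) (hIS : I * S ≤ I) {n : ℕ} (hn : ∀ a ∈ S, a ^ (n + 1) ∈ I)
    {a b c : M} (ha : a ∈ S) (hb : b ∈ S) (hc : c ∈ S) : a ^ n * c * b ^ n ∈ I := by
  have mulS : ∀ {x y : M}, x ∈ S → y ∈ S → x * y ∈ S := fun hx hy =>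
    hS (Submodule.mul_mem_mul hx hy)
  have mulpow : ∀ {x y : M}, x ∈ S → y ∈ S → ∀ j, x * y ^ j ∈ S := fun hx hy j => by
    cases j with
    | zero => simpa
    | succ j => exact mulS hx (pow_mem_of_mul_le hS hy j)
  have powmul : ∀ {x y : M}, x ∈ S → y ∈ S → ∀ j, x ^ j * y ∈ S := fun hx hy j => by
    cases j with
    | zero => simpa
    | succ j => exact mulS (pow_mem_of_mul_le hS hx j) hy
  have Imulpow : ∀ {x y : M}, x ∈ I → y ∈ S → ∀ j, x * y ^ j ∈ I := fun hx hy j => by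
    cases j with
    | zero => simpa
    | succ j => exact hIS (Submodule.mul_mem_mul hx (pow_mem_of_mul_le hS hy j))
  have hsum : ∑ j ∈ Finset.range (n + 1),
      (∑ i ∈ Finset.range (n + 1), a ^ i * (c * b ^ j) * a ^ (n - i)) * b ^ (n - j) ∈ I :=
    I.sum_mem fun j _ => Imulpow (sum_pow_mul_mul_pow_mem hn ha (mulpow hc hb j)) hb _
  have heq : ∑ j ∈ Finset.range (n + 1),
      (∑ i ∈ Finset.range (n + 1), a ^ i * (c * b ^ j) * a ^ (n - i)) * b ^ (n - j)
      = ∑ i ∈ Finset.range (n + 1), (a ^ i * c) *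
        ∑ j ∈ Finset.range (n + 1), b ^ j * a ^ (n - i) * b ^ (n - j) := by
    simp_rw [Finset.sum_mul, Finset.mul_sum]
    rw [Finset.sum_comm]
    simp only [mul_assoc]
  rw [heq, Finset.sum_range_succ] at hsum
  have hlow : ∑ i ∈ Finset.range n, (a ^ i * c) *
      ∑ j ∈ Finset.range (n + 1), b ^ j * a ^ (n - i) * b ^ (n - j) ∈ I := by
    refine I.sum_mem fun i hi => hSI (Submodule.mul_mem_mul (powmul ha hc i) ?_)
    obtain ⟨k, hk⟩ : ∃ k, n - i = k + 1 := ⟨n - i - 1, by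
      have := Finset.mem_range.mp hi; omega⟩
    exact sum_pow_mul_mul_pow_mem hn hb (hk ▸ pow_mem_of_mul_le hS ha k)
  have htop := (I.add_mem_iff_right hlow).mp hsum
  have hconst : ∑ j ∈ Finset.range (n + 1), b ^ j * a ^ (n - n) * b ^ (n - j)
      = ((n + 1 : ℕ) : K) • b ^ n := by
    rw [Finset.sum_congr rfl (g := fun _ => b ^ n)]
    · rw [Finset.sum_const, Finset.card_range, Nat.cast_smul_eq_nsmul]
    · intro j hj
      have := Finset.mem_range.mp hj
      simp only [Nat.sub_self, pow_zero, mul_one, ← pow_add]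
      congr 1; omega
  rw [hconst, mul_smul_comm] at htop
  exact (I.smul_mem_iff (Nat.cast_ne_zero.mpr (Nat.succ_ne_zero n))).mp htop

/-- The **Nagata–Higman theorem**: a (non-unital) nil algebra of index `n + 1` over a field of
characteristic zero is nilpotent. It is stated for a subalgebra `S` modulo an ideal `I` of `S`. -/
theorem nagata_higman [CharZero K] (n : ℕ) {S I : Submodule K M} (hS : S * S ≤ S) (hI : I ≤ S)
    (hSI : S * I ≤ I) (hIS : I * S ≤ I) (hn : ∀ a ∈ S, a ^ (n + 1) ∈ I) :
    S ^ (2 ^ (n + 1) - 1) ≤ I := by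
  induction n generalizing I with
  | zero => intro a ha; simpa using hn a (by simpa using ha)
  | succ n ih =>
    let U : Submodule K M := 1 ⊔ S
    let J : Submodule K M := Submodule.span K {x | ∃ a ∈ S, x = a ^ (n + 1)}
    have hU1 : 1 ≤ U := le_sup_left
    have hUS : U * S ≤ S := by
      simp only [U, Submodule.sup_mul, one_mul, sup_le_iff, le_refl, true_and, hS]
    have hSU : S * U ≤ S := by
      simp only [U, Submodule.mul_sup, mul_one, sup_le_iff, le_refl, true_and, hS]
    have hUI : U * I ≤ I := by
      simp only [U, Submodule.sup_mul, one_mul, sup_le_iff, le_refl, true_and, hSI]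
    have hIU : I * U ≤ I := by
      simp only [U, Submodule.mul_sup, mul_one, sup_le_iff, le_refl, true_and, hIS]
    have hSleU : S ≤ U := le_sup_right
    have hJS : J ≤ S := Submodule.span_le.mpr (by
      rintro _ ⟨a, ha, rfl⟩; exact pow_mem_of_mul_le hS ha n)
    have hJSJ : J * S * J ≤ I := by
      rw [← Submodule.span_eq S, Submodule.span_mul_span, Submodule.span_mul_span,
        Submodule.span_le]
      rintro _ ⟨_, ⟨_, ⟨a, ha, rfl⟩, c, hc, rfl⟩, _, ⟨b, hb, rfl⟩, rfl⟩
      exact pow_mul_mul_pow_mem hS hSI hIS hn ha hb hc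
    let I' : Submodule K M := I ⊔ U * J * U
    have hI'S : I' ≤ S := sup_le hI <| calc
      U * J * U ≤ U * S * U := by gcongr
      _ ≤ S * U := by gcongr
      _ ≤ S := hSU
    have hSI' : S * I' ≤ I' := by
      simp only [I', Submodule.mul_sup]
      refine sup_le_sup hSI ?_
      rw [← mul_assoc, ← mul_assoc]
      gcongr
      exact hSU.trans hSleU
    have hI'S' : I' * S ≤ I' := by
      simp only [I', Submodule.sup_mul]
      refine sup_le_sup hIS ?_
      rw [mul_assoc (U * J)]
      gcongr
      exact hUS.trans hSleU
    have hpow := ih hI'S hSI' hI'S' (fun a ha => by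
      refine le_sup_right (a := I) ?_
      have : a ^ (n + 1) ∈ J := Submodule.subset_span ⟨a, ha, rfl⟩
      simpa using Submodule.mul_mem_mul
        (Submodule.mul_mem_mul (hU1 (Submodule.one_le.mp le_rfl)) this)
        (hU1 (Submodule.one_le.mp le_rfl)))
    have hexp : 2 ^ (n + 1 + 1) - 1 = (2 ^ (n + 1) - 1) + 1 + (2 ^ (n + 1) - 1) := by
      have := Nat.one_le_two_pow (n := n + 1)
      rw [pow_succ 2 (n + 1)]; omega
    rw [hexp, pow_add, pow_add, pow_one]
    calc _ ≤ I' * S * I' := by gcongr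
      _ ≤ I := by
        simp only [I', Submodule.sup_mul, Submodule.mul_sup]
        have hUJU : U * J * U ≤ S := le_sup_right.trans hI'S
        refine sup_le (sup_le ?_ ?_) (sup_le ?_ ?_)
        · exact (mul_le_mul_left hIS I).trans ((mul_le_mul_left hI I).trans hSI)
        · exact (mul_le_mul_left hUJU S |> fun h => mul_le_mul_left h I) |>.trans
            ((mul_le_mul_left hS I).trans hSI)
        · exact (mul_le_mul_left hIS _).trans ((mul_le_mul_right hUJU I).trans hIS)
        · calc U * J * U * S * (U * J * U) = U * (J * (U * S * U) * J) * U := by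
                simp only [mul_assoc]
            _ ≤ U * (J * (S * U) * J) * U := by gcongr
            _ ≤ U * (J * S * J) * U := by gcongr
            _ ≤ U * I * U := by gcongr
            _ ≤ I * U := by gcongr
            _ ≤ I := hIU

end NagataHigman

section Eigenvalues

lemma Matrix.det_aeval_eq_prod {Ω : Type*} [Field Ω] [IsAlgClosed Ω] {m : ℕ}
    (A : Matrix (Fin m) (Fin m) Ω) (μ : Fin m → Ω)
    (hμ : A.charpoly = ∏ i, (Polynomial.X - Polynomial.C (μ i))) (q : Polynomial Ω) :
    (Polynomial.aeval A q).det = ∏ i, q.eval (μ i) := by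
  have hlin : ∀ b : Ω, (Polynomial.aeval A (Polynomial.X - Polynomial.C b)).det
      = ∏ i, (Polynomial.X - Polynomial.C b).eval (μ i) := fun b => by
    have h1 : Polynomial.aeval A (Polynomial.X - Polynomial.C b)
        = -(Matrix.scalar (Fin m) b - A) := by
      rw [neg_sub, map_sub, Polynomial.aeval_C, Polynomial.aeval_X]; rfl
    rw [h1, det_neg, ← Matrix.eval_charpoly, hμ, Polynomial.eval_prod, ← Finset.card_univ,
      ← Finset.prod_const, ← Finset.prod_mul_distrib]
    simp
  let f : Polynomial Ω →* Ω :=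
    (Matrix.detMonoidHom).comp (Polynomial.aeval A).toRingHom.toMonoidHom
  let g : Polynomial Ω →* Ω :=
    ∏ i, ((Polynomial.evalRingHom (μ i) : Polynomial Ω →+* Ω) : Polynomial Ω →* Ω)
  have hg : ∀ q, g q = ∏ i, q.eval (μ i) := fun q => by simp [g]
  have hf : ∀ q, f q = (Polynomial.aeval A q).det := fun q => rfl
  rw [← hf, ← hg, (IsAlgClosed.splits q).eq_prod_roots, map_mul, map_mul, map_multiset_prod,
    map_multiset_prod, Multiset.map_map, Multiset.map_map]
  congr 1
  · rw [hf, hg, Polynomial.aeval_C, Matrix.algebraMap_eq_diagonal]; simp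
  · congr 1
    refine Multiset.map_congr rfl fun b _ => ?_
    simp only [Function.comp_apply, hf, hg, hlin]

/-- Over an algebraically closed field, traces of powers are power sums of eigenvalues. -/
lemma Matrix.exists_eigenvalues {Ω : Type*} [Field Ω] [IsAlgClosed Ω] {m : ℕ}
    (A : Matrix (Fin m) (Fin m) Ω) : ∃ μ : Fin m → Ω,
      A.charpoly = ∏ i, (Polynomial.X - Polynomial.C (μ i)) ∧
      ∀ j : ℕ, (A ^ j).trace = ∑ i, μ i ^ j := by
  obtain ⟨μ, hμ⟩ : ∃ μ : Fin m → Ω, A.charpoly = ∏ i, (Polynomial.X - Polynomial.C (μ i)) := by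
    have hsplit := IsAlgClosed.splits A.charpoly
    have hcard : A.charpoly.roots.toList.length = m := by
      rw [Multiset.length_toList, ← hsplit.natDegree_eq_card_roots,
        A.charpoly_natDegree_eq_dim, Fintype.card_fin]
    refine ⟨fun i => A.charpoly.roots.toList.get (i.cast hcard.symm), ?_⟩
    conv_lhs => rw [hsplit.eq_prod_roots, A.charpoly_monic.leadingCoeff, map_one, one_mul,
      ← Multiset.coe_toList A.charpoly.roots, Multiset.map_coe, Multiset.prod_coe,
      ← Fin.prod_univ_fun_getElem]
    exact (Fintype.prod_equiv (finCongr hcard.symm) _ _ fun i => rfl).symm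
  refine ⟨μ, hμ, fun j => ?_⟩
  have hpow : (A ^ j).charpoly = ∏ i, (Polynomial.X - Polynomial.C (μ i ^ j)) := by
    refine Polynomial.funext fun y => ?_
    have h2 : Matrix.scalar (Fin m) y - A ^ j
        = Polynomial.aeval A (Polynomial.C y - Polynomial.X ^ j) := by
      rw [map_sub, Polynomial.aeval_C, Polynomial.aeval_X_pow]; rfl
    rw [Matrix.eval_charpoly, h2, A.det_aeval_eq_prod μ hμ, Polynomial.eval_prod]
    simp
  have hroots := Polynomial.roots_multiset_prod_X_sub_C (Finset.univ.val.map (μ · ^ j))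
  rw [Multiset.map_map] at hroots
  rw [trace_eq_sum_roots_charpoly, hpow]
  exact congrArg Multiset.sum hroots

lemma MvPolynomial.aeval_esymm_mem {K Ω : Type*} [Field K] [CharZero K] [Field Ω] [Algebra K Ω]
    (P : NonUnitalSubalgebra K Ω) {m : ℕ} (μ : Fin m → Ω)
    (h : ∀ j, 0 < j → ∑ i, μ i ^ j ∈ P) (k : ℕ) (hk : 0 < k) :
    aeval μ (esymm (Fin m) K k) ∈ P := by
  induction k using Nat.strong_induction_on with
  | _ k ih =>
    have hpsum : ∀ j, 0 < j → aeval μ (psum (Fin m) K j) ∈ P := fun j hj => by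
      simpa [psum] using h j hj
    have hsign : ∀ (n : ℕ) {x : Ω}, x ∈ P → (-1) ^ n * x ∈ P := fun n x hx => by
      rcases neg_one_pow_eq_or Ω n with h | h <;> simp [h, hx]
    have newton := congrArg (aeval μ) (mul_esymm_eq_sum (Fin m) K k)
    simp only [map_mul, map_natCast, map_sum, map_pow, map_neg, map_one] at newton
    have hmem : (k : Ω) * aeval μ (esymm (Fin m) K k) ∈ P := by
      rw [newton]
      refine hsign _ (sum_mem fun a ha => ?_)
      rw [Finset.mem_filter, Finset.HasAntidiagonal.mem_antidiagonal] at ha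
      rw [mul_assoc]
      refine hsign _ ?_
      rcases Nat.eq_zero_or_pos a.1 with h0 | h0
      · simpa [h0] using hpsum a.2 (by omega)
      · exact mul_mem (ih _ ha.2 h0) (hpsum _ (by omega))
    have hk0 : (k : K) ≠ 0 := Nat.cast_ne_zero.mpr hk.ne'
    have := P.smul_mem hmem (r := (k : K)⁻¹)
    rwa [← map_natCast (algebraMap K Ω), ← Algebra.smul_def, smul_smul,
      inv_mul_cancel₀ hk0, one_smul] at this

/-- Coefficients of the characteristic polynomial are polynomials without constant term in the
traces of the powers of the matrix. -/
lemma Matrix.charpoly_coeff_mem {K R : Type*} [Field K] [CharZero K] [CommRing R] [IsDomain R]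
    [Algebra K R] (P : NonUnitalSubalgebra K R) {m : ℕ} (A : Matrix (Fin m) (Fin m) R)
    (h : ∀ j, 0 < j → (A ^ j).trace ∈ P) {k : ℕ} (hk : k < m) : A.charpoly.coeff k ∈ P := by
  let Ω := AlgebraicClosure (FractionRing R)
  let ι : R →ₐ[K] Ω := IsScalarTower.toAlgHom K R Ω
  have hι : Function.Injective ι := by
    change Function.Injective (algebraMap R Ω)
    rw [IsScalarTower.algebraMap_eq R (FractionRing R) Ω]
    exact (algebraMap (FractionRing R) Ω).injective.comp (IsFractionRing.injective R _)
  obtain ⟨μ, hμ, htr⟩ := (A.map ι).exists_eigenvalues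
  have hpow : ∀ j, ((A.map ι) ^ j).trace = ι (A ^ j).trace := fun j => by
    have : (A.map ι) ^ j = (A ^ j).map ι := (map_pow ι.mapMatrix A j).symm
    rw [this, AddMonoidHom.map_trace]
  have hcoeff : ι (A.charpoly.coeff k)
      = (-1) ^ (m - k) * aeval μ (esymm (Fin m) K (m - k)) := by
    have h1 : ι (A.charpoly.coeff k) = (A.map ι).charpoly.coeff k := by
      have := A.charpoly_map ι.toRingHom
      erw [this]; simp
    have h2 := Multiset.prod_X_sub_C_coeff (Finset.univ.val.map μ) (k := k) (by simp; omega)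
    rw [Multiset.map_map, Multiset.card_map, Finset.card_val, Finset.card_univ,
      Fintype.card_fin] at h2
    rw [h1, hμ, aeval_esymm_eq_multiset_esymm]
    exact h2
  have hmem : ι (A.charpoly.coeff k) ∈ P.map ι := by
    rw [hcoeff]
    have h3 := aeval_esymm_mem (P.map ι) μ
      (fun j hj => by rw [← htr, hpow]; exact ⟨_, h j hj, rfl⟩) (m - k) (by omega)
    rcases neg_one_pow_eq_or Ω (m - k) with h | h <;> rw [h] <;> simpa using h3
  obtain ⟨x, hx, hxe⟩ := hmem
  exact hι hxe ▸ hx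

end Eigenvalues

section TraceWords

variable {K L : Type*} [Field K] [Field L] [Algebra K L]

/-- Polynomials whose coefficients below degree `n` lie in the subalgebra `E`. -/
def lowCoeffSubalgebra (E : Subalgebra K L) (n : ℕ) : Subalgebra K (Polynomial L) where
  carrier := {p | ∀ j < n, p.coeff j ∈ E}
  mul_mem' := fun {p q} hp hq j hj => by
    rw [Polynomial.coeff_mul]
    refine sum_mem fun a ha => ?_
    have := Finset.HasAntidiagonal.mem_antidiagonal.mp ha
    exact mul_mem (hp _ (by omega)) (hq _ (by omega))
  add_mem' := fun {p q} hp hq j hj => by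
    rw [Polynomial.coeff_add]; exact add_mem (hp j hj) (hq j hj)
  algebraMap_mem' := fun x j _ => by
    rw [IsScalarTower.algebraMap_apply K L (Polynomial L), Polynomial.algebraMap_apply,
      Algebra.algebraMap_self, RingHom.id_apply, Polynomial.coeff_C]
    split_ifs
    · exact E.algebraMap_mem x
    · exact zero_mem E

/-- Polynomials without constant term whose coefficients below degree `n` lie in `E`. -/
def lowCoeffAugmentation (E : Subalgebra K L) (n : ℕ) : NonUnitalSubalgebra K (Polynomial L) where
  carrier := {p | p.coeff 0 = 0 ∧ p ∈ lowCoeffSubalgebra E n}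
  mul_mem' := fun {p q} hp hq => ⟨by simp [Polynomial.mul_coeff_zero, hp.1], mul_mem hp.2 hq.2⟩
  add_mem' := fun {p q} hp hq => ⟨by simp [hp.1, hq.1], add_mem hp.2 hq.2⟩
  zero_mem' := ⟨by simp, zero_mem _⟩
  smul_mem' := fun c p hp => ⟨by simp [hp.1], (lowCoeffSubalgebra E n).smul_mem hp.2 c⟩

lemma mul_mem_lowCoeffAugmentation {E : Subalgebra K L} {n : ℕ} {p q : Polynomial L}
    (hp : p ∈ lowCoeffSubalgebra E n) (hq : q ∈ lowCoeffAugmentation E n) :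
    p * q ∈ lowCoeffAugmentation E n :=
  ⟨by simp [Polynomial.mul_coeff_zero, hq.1], mul_mem hp hq.2⟩

lemma coeff_mul_mem_of_mem_lowCoeffAugmentation {E : Subalgebra K L} {n : ℕ} {p q : Polynomial L}
    (hp : p ∈ lowCoeffAugmentation E n) (hq : q ∈ lowCoeffAugmentation E n) :
    (p * q).coeff n ∈ E := by
  rw [Polynomial.coeff_mul]
  refine sum_mem fun a ha => ?_
  have hsum := Finset.HasAntidiagonal.mem_antidiagonal.mp ha
  rcases Nat.eq_zero_or_pos a.1 with h0 | h0
  · rw [h0, hp.1, zero_mul]; exact zero_mem E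
  rcases Nat.eq_zero_or_pos a.2 with h1 | h1
  · rw [h1, hq.1, mul_zero]; exact zero_mem E
  exact mul_mem (hp.2 _ (by omega)) (hq.2 _ (by omega))

variable {m r : ℕ}

/-- The generic homogeneous deformation `s ↦ s X` of a tuple of matrices. -/
noncomputable def scaledTuple (X : Fin r → Matrix (Fin m) (Fin m) L) :
    Fin r → Matrix (Fin m) (Fin m) (Polynomial L) :=
  fun i => (Polynomial.X : Polynomial L) • (X i).map Polynomial.C

lemma scaledTuple_word (X : Fin r → Matrix (Fin m) (Fin m) L) (w : List (Fin r)) :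
    (w.map (scaledTuple X)).prod
      = (Polynomial.X : Polynomial L) ^ w.length • ((w.map X).prod).map Polynomial.C := by
  induction w with
  | nil => simp
  | cons i w ih =>
    rw [List.map_cons, List.prod_cons, ih, List.map_cons, List.prod_cons, List.length_cons,
      Matrix.map_mul, scaledTuple, smul_mul_smul_comm, pow_succ']

lemma trace_scaledTuple_word (X : Fin r → Matrix (Fin m) (Fin m) L) (w : List (Fin r)) :
    ((w.map (scaledTuple X)).prod).trace
      = Polynomial.C ((w.map X).prod).trace * Polynomial.X ^ w.length := by
  rw [scaledTuple_word, trace_smul, smul_eq_mul, mul_comm, AddMonoidHom.map_trace]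

/-- The span of the multiples by elements of `P` of the nonempty words in the tuple `Y`. -/
def wordSpan (K : Type*) {R : Type*} [Field K] [CommRing R] [Algebra K R]
    (Y : Fin r → Matrix (Fin m) (Fin m) R) (P : Set R) :
    Submodule K (Matrix (Fin m) (Fin m) R) :=
  Submodule.span K {z | ∃ q ∈ P, ∃ w : List (Fin r), w ≠ [] ∧ z = q • (w.map Y).prod}

lemma wordSpan_mul_le {R : Type*} [CommRing R] [Algebra K R]
    (Y : Fin r → Matrix (Fin m) (Fin m) R) {P P' P'' : Set R}
    (h : ∀ p ∈ P, ∀ q ∈ P', p * q ∈ P'') :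
    wordSpan K Y P * wordSpan K Y P' ≤ wordSpan K Y P'' := by
  rw [wordSpan, wordSpan, Submodule.span_mul_span, Submodule.span_le]
  rintro _ ⟨_, ⟨p, hp, w, hw, rfl⟩, _, ⟨q, hq, u, -, rfl⟩, rfl⟩
  refine Submodule.subset_span ⟨p * q, h p hp q hq, w ++ u, by simp [hw], ?_⟩
  rw [List.map_append, List.prod_append]
  exact smul_mul_smul_comm _ _ _ _

lemma smul_mem_wordSpan {R : Type*} [CommRing R] [Algebra K R]
    (Y : Fin r → Matrix (Fin m) (Fin m) R) {P P' : Set R} {p : R} (h : ∀ q ∈ P, p * q ∈ P')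
    {z : Matrix (Fin m) (Fin m) R} (hz : z ∈ wordSpan K Y P) : p • z ∈ wordSpan K Y P' := by
  induction hz using Submodule.span_induction with
  | mem z hz =>
    obtain ⟨q, hq, w, hw, rfl⟩ := hz
    exact Submodule.subset_span ⟨p * q, h q hq, w, hw, smul_smul _ _ _⟩
  | zero => simp
  | add x y _ _ hx hy => rw [smul_add]; exact add_mem hx hy
  | smul c x _ hx => rw [smul_comm]; exact Submodule.smul_mem _ _ hx

/-- In characteristic zero, the traces of all words are polynomials in the traces of words of
length at most `2 ^ (m + 1)`. -/
theorem trace_word_mem_of_short_words [CharZero K] (X : Fin r → Matrix (Fin m) (Fin m) L)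
    (E : Subalgebra K L)
    (h : ∀ w : List (Fin r), w ≠ [] → w.length ≤ 2 ^ (m + 1) → ((w.map X).prod).trace ∈ E)
    (w : List (Fin r)) (hw : w ≠ []) : ((w.map X).prod).trace ∈ E := by
  induction hn : w.length using Nat.strong_induction_on generalizing w with
  | _ n ih =>
  by_cases hle : n ≤ 2 ^ (m + 1)
  · exact h w hw (hn ▸ hle)
  let Y := scaledTuple X
  let S := wordSpan K Y (lowCoeffSubalgebra E n)
  let I := wordSpan K Y (lowCoeffAugmentation E n)
  have htrword : ∀ u : List (Fin r), u ≠ [] →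
      ((u.map Y).prod).trace ∈ lowCoeffAugmentation E n := fun u hu => by
    have hpos : 0 < u.length := List.length_pos_iff.mpr hu
    rw [trace_scaledTuple_word]
    refine ⟨by simp [hpos.ne], fun j hj => ?_⟩
    rw [Polynomial.coeff_C_mul_X_pow]
    split_ifs with hju
    · exact ih u.length (hju ▸ hj) u hu rfl
    · exact zero_mem E
  have htr : ∀ z ∈ S, z.trace ∈ lowCoeffAugmentation E n := fun z hz => by
    induction hz using Submodule.span_induction with
    | mem z hz =>
      obtain ⟨q, hq, u, hu, rfl⟩ := hz
      rw [trace_smul]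
      exact mul_mem_lowCoeffAugmentation hq (htrword u hu)
    | zero => simp
    | add x y _ _ hx hy => rw [trace_add]; exact add_mem hx hy
    | smul c x _ hx => rw [trace_smul]; exact SMulMemClass.smul_mem c hx
  have hS : S * S ≤ S := wordSpan_mul_le Y fun p hp q hq => mul_mem hp hq
  have hI : I ≤ S := Submodule.span_mono fun z => by
    rintro ⟨q, hq, u, hu, rfl⟩
    exact ⟨q, hq.2, u, hu, rfl⟩
  have hSI : S * I ≤ I := wordSpan_mul_le Y fun p hp q hq => mul_mem_lowCoeffAugmentation hp hq
  have hIS : I * S ≤ I := wordSpan_mul_le Y fun p hp q hq => by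
    rw [mul_comm]; exact mul_mem_lowCoeffAugmentation hq hp
  have hnil : ∀ a ∈ S, a ^ (m + 1) ∈ I := fun a ha => by
    have hpow := fun i => pow_mem_of_mul_le hS ha i
    have hcoeff : ∀ i < m, a.charpoly.coeff i ∈ lowCoeffAugmentation E n := fun i hi =>
      a.charpoly_coeff_mem _ (fun j hj => by
        obtain ⟨k, rfl⟩ := Nat.exists_eq_succ_of_ne_zero hj.ne'
        exact htr _ (hpow k)) hi
    have hCH := a.aeval_self_charpoly
    rw [Polynomial.aeval_eq_sum_range, a.charpoly_natDegree_eq_dim, Fintype.card_fin,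
      Finset.sum_range_succ] at hCH
    have hlead : a.charpoly.coeff m = 1 := by
      have := a.charpoly_monic
      rwa [Polynomial.Monic, Polynomial.leadingCoeff, a.charpoly_natDegree_eq_dim,
        Fintype.card_fin] at this
    rw [hlead, one_smul, add_comm, add_eq_zero_iff_eq_neg] at hCH
    rw [pow_succ, hCH, neg_mul, Finset.sum_mul]
    refine neg_mem (sum_mem fun i hi => ?_)
    rw [smul_mul_assoc, ← pow_succ]
    exact smul_mem_wordSpan Y (fun q hq => by
      rw [mul_comm]
      exact mul_mem_lowCoeffAugmentation hq (hcoeff i (Finset.mem_range.mp hi))) (hpow i)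
  have hNH := nagata_higman m hS hI hSI hIS hnil
  have hSpow : ∀ k, S ^ (2 ^ (m + 1) - 1 + k) ≤ I := fun k => by
    induction k with
    | zero => exact hNH
    | succ k ihk => rw [← add_assoc, pow_succ]; exact (mul_le_mul_left ihk S).trans hIS
  have hword : ∀ u : List (Fin r), (u.map Y).prod ∈ S ^ u.length := fun u => by
    induction u with
    | nil => exact Submodule.one_le.mp le_rfl
    | cons i u ihu =>
      rw [List.map_cons, List.prod_cons, List.length_cons, pow_succ']
      exact Submodule.mul_mem_mul
        (Submodule.subset_span ⟨1, one_mem _, [i], by simp, by simp⟩) ihu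
  obtain ⟨u, x, rfl⟩ : ∃ u x, w = u ++ [x] := ⟨_, _, (List.dropLast_append_getLast hw).symm⟩
  have hlen : u.length + 1 = n := by simpa using hn
  have huI : (u.map Y).prod ∈ I := by
    have := hSpow (u.length - (2 ^ (m + 1) - 1))
    rw [Nat.add_sub_cancel' (by omega)] at this
    exact this (hword u)
  have hfinal : ∀ z ∈ I, (z * Y x).trace.coeff n ∈ E := fun z hz => by
    induction hz using Submodule.span_induction with
    | mem z hz =>
      obtain ⟨q, hq, v, -, rfl⟩ := hz
      rw [smul_mul_assoc, trace_smul, smul_eq_mul]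
      refine coeff_mul_mem_of_mem_lowCoeffAugmentation hq ?_
      simpa using htrword (v ++ [x]) (by simp)
    | zero => simp
    | add a b _ _ ha hb => rw [add_mul, trace_add, Polynomial.coeff_add]; exact add_mem ha hb
    | smul c a _ ha =>
      rw [smul_mul_assoc, trace_smul, Polynomial.coeff_smul]; exact E.smul_mem ha c
  have hres := hfinal _ huI
  have hprod : (u.map Y).prod * Y x = ((u ++ [x]).map Y).prod := by simp
  rw [hprod, trace_scaledTuple_word, Polynomial.coeff_C_mul_X_pow, if_pos hn.symm] at hres
  exact hres

end TraceWords

section Gram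

variable {k : Type*} [Field k]

lemma exists_minor_ne_zero_of_linearIndependent {J : Type*} {n : ℕ} (f : Fin n → J → k)
    (hf : LinearIndependent k f) : ∃ b : Fin n → J, (Matrix.of fun i j => f i (b j)).det ≠ 0 := by
  let c : J → Fin n → k := fun j i => f i j
  have hspan : Submodule.span k (Set.range c) = ⊤ := by
    by_contra hne
    obtain ⟨φ, hφ, hle⟩ := Submodule.exists_le_ker_of_lt_top _ (lt_top_iff_ne_top.mpr hne)
    refine hφ (LinearMap.pi_ext' fun i => LinearMap.ext_ring ?_)
    have hsum : ∑ i, φ (Pi.single i 1) • f i = 0 := by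
      ext j
      have h0 : φ (c j) = 0 := hle (Submodule.subset_span ⟨j, rfl⟩)
      rw [← Finset.univ_sum_single (c j), map_sum] at h0
      simp only [Finset.sum_apply, Pi.smul_apply, smul_eq_mul, Pi.zero_apply]
      rw [← h0]
      refine Finset.sum_congr rfl fun i _ => ?_
      rw [mul_comm, ← smul_eq_mul, ← map_smul, ← Pi.single_smul, smul_eq_mul, mul_one]
    simpa using Fintype.linearIndependent_iff.mp hf _ hsum i
  obtain ⟨s, hsc, hs, hli⟩ := exists_linearIndependent k (Set.range c)
  let B : Module.Basis s k (Fin n → k) := Module.Basis.mk hli (by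
    rw [Subtype.range_coe, hs, hspan])
  let e : Fin n ≃ s := (Pi.basisFun k (Fin n)).indexEquiv B
  choose b hb using fun i => hsc (e i).2
  refine ⟨b, ?_⟩
  have hcols : LinearIndependent k (Matrix.of fun i j => f i (b j)).col := by
    have : (Matrix.of fun i j => f i (b j)).col = (fun x : s => (x : Fin n → k)) ∘ e := by
      ext j i
      exact congrFun (hb j) i
    rw [this]
    exact hli.comp _ e.injective
  exact ((Matrix.isUnit_iff_isUnit_det _).mp
    (Matrix.linearIndependent_cols_iff_isUnit.mp hcols)).ne_zero

/-- If all `(n + 1)`-minors of an infinite matrix vanish, its row space has dimension at most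
`n`. -/
lemma span_rows_finite_of_minors_eq_zero {I J : Type*} (G : I → J → k) (n : ℕ)
    (h : ∀ (a : Fin (n + 1) → I) (b : Fin (n + 1) → J),
      (Matrix.of fun i j => G (a i) (b j)).det = 0) :
    FiniteDimensional k (Submodule.span k (Set.range G)) ∧
      Module.finrank k (Submodule.span k (Set.range G)) ≤ n := by
  obtain ⟨s, hsG, hs, hli⟩ := exists_linearIndependent k (Set.range G)
  have hcard : s.encard ≤ n := by
    by_contra hlt
    obtain ⟨t, hts, ht⟩ := Set.exists_subset_encard_eq (s := s) (k := (n + 1 : ℕ)) (by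
      rw [Nat.cast_add, Nat.cast_one]; exact Order.add_one_le_of_lt (not_le.mp hlt))
    have htfin : t.Finite := Set.finite_of_encard_eq_coe ht
    have : Finite t := htfin
    have htc : Nat.card t = n + 1 := by
      rw [Nat.card_coe_set_eq, Set.ncard, ht]; rfl
    let e : Fin (n + 1) ≃ t := (Finite.equivFinOfCardEq htc).symm
    choose a ha using fun i => hsG (hts (e i).2)
    obtain ⟨b, hb⟩ := exists_minor_ne_zero_of_linearIndependent (fun i => G (a i)) (by
      have hcomp : (fun i => G (a i)) =
          (fun x : s => (x : J → k)) ∘ (Set.inclusion hts) ∘ e := by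
        ext i j
        exact congrFun (ha i) j
      rw [hcomp]
      exact hli.comp _ ((Set.inclusion_injective hts).comp e.injective))
    exact hb (h a b)
  have hfin : s.Finite := Set.finite_of_encard_le_coe hcard
  rw [← hs]
  refine ⟨FiniteDimensional.span_of_finite k hfin, ?_⟩
  have := hfin.fintype
  rw [finrank_span_set_eq_card hli, ← Set.ncard_eq_toFinset_card']
  have h2 : ((s.ncard : ℕ) : ℕ∞) ≤ n := by rwa [hfin.cast_ncard_eq]
  exact_mod_cast h2

lemma det_trace_mul_eq_zero {m : ℕ}
    (A B : Fin (m ^ 2 + 1) → Matrix (Fin m) (Fin m) k) :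
    (Matrix.of fun i j => (A i * B j).trace).det = 0 := by
  let P : Matrix (Fin (m ^ 2 + 1)) (Fin m × Fin m) k := fun i x => A i x.1 x.2
  let Q : Matrix (Fin m × Fin m) (Fin (m ^ 2 + 1)) k := fun x j => B j x.2 x.1
  have hPQ : (Matrix.of fun i j => (A i * B j).trace) = P * Q := by
    ext i j
    rw [Matrix.mul_apply, Fintype.sum_prod_type]
    simp [Matrix.trace, Matrix.mul_apply, P, Q]
  by_contra hdet
  have hrank := Matrix.rank_of_isUnit _ ((Matrix.isUnit_iff_isUnit_det _).mpr (Ne.isUnit hdet))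
  rw [hPQ, Fintype.card_fin] at hrank
  have h1 := (Matrix.rank_mul_le_left P Q).trans (Matrix.rank_le_card_width P)
  rw [Fintype.card_prod, Fintype.card_fin] at h1
  nlinarith

/-- A cyclically invariant function on words, whose Gram matrix has rank at most `n` and which
vanishes on nonempty words of length at most `n`, vanishes on all nonempty words. -/
lemma eq_zero_of_short_words_eq_zero {r n : ℕ} (t : List (Fin r) → k)
    (hcomm : ∀ u v, t (u ++ v) = t (v ++ u))
    (hminor : ∀ a b : Fin (n + 1) → List (Fin r),
      (Matrix.of fun i j => t (a i ++ b j)).det = 0)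
    (hshort : ∀ w, w ≠ [] → w.length ≤ n → t w = 0) (w : List (Fin r)) (hw : w ≠ []) :
    t w = 0 := by
  let ρ : List (Fin r) → List (Fin r) → k := fun u v => t (u ++ v)
  obtain ⟨hfd, hrank⟩ := span_rows_finite_of_minors_eq_zero ρ n hminor
  let V : ℕ → Submodule k (List (Fin r) → k) := fun j =>
    Submodule.span k (ρ '' {u | u ≠ [] ∧ u.length ≤ j})
  have hVle : ∀ j, V j ≤ Submodule.span k (Set.range ρ) := fun j =>
    Submodule.span_mono (Set.image_subset_range _ _)
  have hVfd : ∀ j, FiniteDimensional k (V j) := fun j => Submodule.finiteDimensional_of_le (hVle j)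
  have hmono : Monotone V := fun i j hij =>
    Submodule.span_mono (Set.image_mono fun u hu => ⟨hu.1, hu.2.trans hij⟩)
  obtain ⟨j, hjn, hj⟩ : ∃ j ≤ n, V (j + 1) ≤ V j := by
    by_contra! hcon
    have hdim : ∀ j ≤ n + 1, j ≤ Module.finrank k (V j) := fun j => by
      induction j with
      | zero => simp
      | succ j ih =>
        intro hj
        have hlt : V j < V (j + 1) := lt_of_le_not_ge (hmono (Nat.le_succ j)) (hcon j (by omega))
        have := Submodule.finrank_lt_finrank_of_lt hlt
        have := ih (by omega)
        omega
    have := hdim (n + 1) le_rfl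
    have := Submodule.finrank_mono (hVle (n + 1))
    omega
  have hall : ∀ u, u ≠ [] → ρ u ∈ V j := fun u => by
    induction u with
    | nil => simp
    | cons x u ih =>
      intro _
      by_cases hu : u = []
      · subst hu
        exact hj (Submodule.subset_span ⟨[x], by simp, rfl⟩)
      · let R : (List (Fin r) → k) →ₗ[k] (List (Fin r) → k) :=
          LinearMap.funLeft k k (fun v => v ++ [x])
        have hR : ∀ u, R (ρ u) = ρ (x :: u) := fun u => by
          ext v
          change t (u ++ (v ++ [x])) = t (x :: u ++ v)
          rw [← List.append_assoc, hcomm]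
          rfl
        have hRV : (V j).map R ≤ V (j + 1) := by
          rw [Submodule.map_span, Submodule.span_le]
          rintro _ ⟨_, ⟨u, hu, rfl⟩, rfl⟩
          rw [hR]
          exact Submodule.subset_span ⟨x :: u, ⟨by simp, by simpa using hu.2⟩, rfl⟩
        rw [← hR]
        exact hj (hRV ⟨_, ih hu, rfl⟩)
  have heval : V j ≤
      LinearMap.ker (LinearMap.proj (R := k) (φ := fun _ => k) ([] : List (Fin r))) := by
    rw [Submodule.span_le]
    rintro _ ⟨u, hu, rfl⟩
    simpa [ρ] using hshort u hu.1 (hu.2.trans hjn)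
  simpa [ρ] using heval (hall w hw)

end Gram

section Integrality

variable {K L : Type*} [Field K] [CharZero K] [Field L] [IsAlgClosed L] [Algebra K L] {m r : ℕ}

lemma trace_word_smul {R : Type*} [CommRing R] (c : R) (X : Fin r → Matrix (Fin m) (Fin m) R)
    (w : List (Fin r)) :
    ((w.map (fun i => c • X i)).prod).trace = c ^ w.length * ((w.map X).prod).trace := by
  have : (w.map (fun i => c • X i)).prod = c ^ w.length • (w.map X).prod := by
    induction w with
    | nil => simp
    | cons i w ih => simp only [List.map_cons, List.prod_cons, ih, List.length_cons, pow_succ',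
        smul_mul_smul_comm]
  rw [this, trace_smul, smul_eq_mul]

/-- A valuation ring containing the traces of all words of length at most `m ^ 2` contains the
traces of all words. -/
theorem ValuationSubring.trace_word_mem (V : ValuationSubring L)
    (hK : ∀ x : K, algebraMap K L x ∈ V) (X : Fin r → Matrix (Fin m) (Fin m) L)
    (h : ∀ w : List (Fin r), w ≠ [] → w.length ≤ m ^ 2 → ((w.map X).prod).trace ∈ V)
    (w : List (Fin r)) (hw : w ≠ []) : ((w.map X).prod).trace ∈ V := by
  let E : Subalgebra K L := { V.toSubring with algebraMap_mem' := hK }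
  let D := 2 ^ (m + 1)
  refine trace_word_mem_of_short_words X E (fun w₀ hw₀ hlen₀ => ?_) w hw
  by_contra hnot
  let s : Set (List (Fin r)) := {u | u ≠ [] ∧ u.length ≤ D}
  have hsfin : s.Finite := (List.finite_length_le (Fin r) D).subset fun u hu => hu.2
  let v := V.valuation
  let f := fun u : List (Fin r) => v ((u.map X).prod).trace ^ (D.factorial / u.length)
  obtain ⟨ws, ⟨hws, hwsD⟩, hmax⟩ := Set.exists_max_image s f hsfin ⟨w₀, hw₀, hlen₀⟩
  have hpos : ∀ u ∈ s, 0 < u.length := fun u hu => List.length_pos_iff.mpr hu.1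
  have hdvd : ∀ u ∈ s, u.length * (D.factorial / u.length) = D.factorial := fun u hu =>
    Nat.mul_div_cancel' (Nat.dvd_factorial (hpos u hu) hu.2)
  have hquot : ∀ u ∈ s, D.factorial / u.length ≠ 0 := fun u hu h0 => by
    have := hdvd u hu
    rw [h0, mul_zero] at this
    exact D.factorial_ne_zero this.symm
  have hv₀ : 1 < v ((w₀.map X).prod).trace := by
    rw [← not_le]
    exact fun hle => hnot ((V.valuation_le_one_iff _).mp hle)
  have hvs : 1 < v ((ws.map X).prod).trace := by
    have h1 : 1 < f w₀ := one_lt_pow₀ hv₀ (hquot w₀ ⟨hw₀, hlen₀⟩)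
    by_contra hle
    exact absurd (h1.trans_le (hmax w₀ ⟨hw₀, hlen₀⟩)) (not_lt.mpr (pow_le_one' (not_lt.mp hle) _))
  obtain ⟨c, hc⟩ := IsAlgClosed.exists_pow_nat_eq ((ws.map X).prod).trace (hpos ws ⟨hws, hwsD⟩)
  have hvc : 1 < v c := by
    by_contra hle
    refine absurd hvs (not_lt.mpr ?_)
    rw [← hc, map_pow]
    exact pow_le_one' (not_lt.mp hle) _
  have hc0 : c ≠ 0 := fun h0 => by simp [h0] at hvc
  let X' := fun i => c⁻¹ • X i
  have hX'short : ∀ u : List (Fin r), u ≠ [] → u.length ≤ D → ((u.map X').prod).trace ∈ E :=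
    fun u hu hlen => by
      refine (V.valuation_le_one_iff _).mp ?_
      rw [trace_word_smul, inv_pow, map_mul, map_inv₀, map_pow]
      refine inv_mul_le_one_of_le₀ ?_ zero_le
      have hus : u ∈ s := ⟨hu, hlen⟩
      refine (pow_le_pow_iff_left₀ zero_le zero_le (hquot u hus)).mp ?_
      have hfs : v c ^ D.factorial = f ws := by
        conv_lhs => rw [← hdvd ws ⟨hws, hwsD⟩]
        rw [pow_mul, ← map_pow, hc]
      rw [← pow_mul, hdvd u hus]
      exact (hmax u hus).trans_eq hfs.symm
  have hX'nonempty := trace_word_mem_of_short_words X' E hX'short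
  have hX' : ∀ u : List (Fin r), ((u.map X').prod).trace ∈ V := fun u => by
    by_cases hu : u = []
    · subst hu
      simp
    · exact hX'nonempty u hu
  let t : List (Fin r) → IsLocalRing.ResidueField V := fun u =>
    IsLocalRing.residue V ⟨((u.map X').prod).trace, hX' u⟩
  have htzero : t ws = 0 := by
    refine eq_zero_of_short_words_eq_zero (n := m ^ 2) t (fun a b => ?_) (fun a b => ?_)
      (fun u hu hlen => ?_) ws hws
    · refine congrArg (IsLocalRing.residue V) (Subtype.ext ?_)
      simp only [List.map_append, List.prod_append]
      exact trace_mul_comm _ _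
    · have hV : (Matrix.of fun i j =>
          (⟨(((a i ++ b j).map X').prod).trace, hX' (a i ++ b j)⟩ : V)).det = 0 := by
        refine Subtype.ext ?_
        have h1 := V.subtype.map_det (Matrix.of fun i j =>
          (⟨(((a i ++ b j).map X').prod).trace, hX' (a i ++ b j)⟩ : V))
        refine h1.trans ?_
        have h2 := det_trace_mul_eq_zero (fun i => ((a i).map X').prod)
          (fun j => ((b j).map X').prod)
        simp_rw [← List.prod_append, ← List.map_append] at h2
        exact h2
      have h3 := (IsLocalRing.residue V).map_det (Matrix.of fun i j =>
          (⟨(((a i ++ b j).map X').prod).trace, hX' (a i ++ b j)⟩ : V))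
      rw [hV, map_zero] at h3
      exact h3.symm
    · rw [IsLocalRing.residue_eq_zero_iff, V.valuation_lt_one_iff]
      change v ((u.map X').prod).trace < 1
      rw [trace_word_smul, map_mul, map_pow, map_inv₀]
      refine mul_lt_one_of_lt_of_le (pow_lt_one₀ zero_le ?_ (List.length_pos_iff.mpr hu).ne') ?_
      · exact inv_lt_one_of_one_lt₀ hvc
      · exact (V.valuation_le_one_iff _).mpr (h u hu hlen)
  have hone : ((ws.map X').prod).trace = 1 := by
    rw [trace_word_smul, ← hc, inv_pow, inv_mul_cancel₀ (pow_ne_zero _ hc0)]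
  have htone : t ws = 1 := by
    have : (⟨((ws.map X').prod).trace, hX' ws⟩ : V) = 1 := Subtype.ext hone
    simp only [t, this, map_one]
  exact one_ne_zero (htone.symm.trans htzero)

end Integrality

section PowerSums

variable {K : Type*} [Field K] [CharZero K] {ι : Type*} [Fintype ι]

/-- If a weighted evaluation functional `q ↦ ∑ i, g (μ i) * q (μ i)` vanishes on all polynomials,
then all weights vanish. -/
lemma weight_eq_zero_of_sum_eval_eq_zero (μ : ι → K) (g : K → K)
    (h : ∀ q : Polynomial K, ∑ i, g (μ i) * q.eval (μ i) = 0) (i : ι) : g (μ i) = 0 := by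
  classical
  let q : Polynomial K :=
    ∏ x ∈ (Finset.univ.image μ).erase (μ i), (Polynomial.X - Polynomial.C x)
  have hq : ∀ k, μ k ≠ μ i → q.eval (μ k) = 0 := fun k hk => by
    rw [Polynomial.eval_prod]
    exact Finset.prod_eq_zero (i := μ k) (by simp [hk]) (by simp)
  have hqi : q.eval (μ i) ≠ 0 := by
    rw [Polynomial.eval_prod]
    refine Finset.prod_ne_zero_iff.mpr fun x hx => ?_
    rw [Polynomial.eval_sub, Polynomial.eval_X, Polynomial.eval_C]
    exact sub_ne_zero.mpr (Finset.ne_of_mem_erase hx).symm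
  have hsum := h q
  rw [← Finset.sum_filter_add_sum_filter_not _ (fun k => μ k = μ i),
    Finset.sum_congr rfl (g := fun _ => g (μ i) * q.eval (μ i)) (fun k hk => by
      rw [(Finset.mem_filter.mp hk).2]),
    Finset.sum_eq_zero (s := Finset.univ.filter fun k => ¬ μ k = μ i) (fun k hk => by
      rw [hq k (Finset.mem_filter.mp hk).2, mul_zero]),
    add_zero, Finset.sum_const, nsmul_eq_mul] at hsum
  have hcard : ((Finset.univ.filter fun k => μ k = μ i).card : K) ≠ 0 := by
    rw [Nat.cast_ne_zero]
    exact Finset.card_ne_zero.mpr ⟨i, by simp⟩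
  exact (mul_eq_zero.mp ((mul_eq_zero.mp hsum).resolve_left hcard)).resolve_right hqi

lemma sum_mul_eval_eq_zero_of_pow {K : Type*} [Field K] (μ : ι → K) (g : K → K)
    (h : ∀ j : ℕ, ∑ i, g (μ i) * μ i ^ j = 0) (q : Polynomial K) :
    ∑ i, g (μ i) * q.eval (μ i) = 0 := by
  induction q using Polynomial.induction_on' with
  | add p q hp hq => simp only [Polynomial.eval_add, mul_add, Finset.sum_add_distrib, hp, hq,
      add_zero]
  | monomial n a =>
    simp only [Polynomial.eval_monomial, mul_left_comm _ a]
    rw [← Finset.mul_sum, h, mul_zero]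

lemma eq_zero_of_sum_pow_eventually_zero (μ : ι → K) (J : ℕ)
    (h : ∀ j, J ≤ j → ∑ i, μ i ^ j = 0) (i : ι) : μ i = 0 := by
  refine eq_zero_of_pow_eq_zero (n := J) (weight_eq_zero_of_sum_eval_eq_zero μ (fun x => x ^ J)
    (sum_mul_eval_eq_zero_of_pow μ (fun x => x ^ J) fun j => ?_) i)
  simp only [← pow_add]
  exact h _ (Nat.le_add_right _ _)

lemma exists_nat_eq_of_sum_pow_const (μ : ι → K) (c : K)
    (h : ∀ j : ℕ, ∑ i, μ i ^ (j + 1) = c) : ∃ n : ℕ, c = n := by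
  classical
  have h01 : ∀ i, μ i = if μ i = 1 then 1 else 0 := fun i => by
    have := weight_eq_zero_of_sum_eval_eq_zero μ (fun x => x * (x - 1))
      (sum_mul_eval_eq_zero_of_pow μ (fun x => x * (x - 1)) fun j => by
        have : ∀ i, μ i * (μ i - 1) * μ i ^ j = μ i ^ (j + 1 + 1) - μ i ^ (j + 1) := fun i => by
          ring
        simp only [this, Finset.sum_sub_distrib, h, sub_self]) i
    rcases mul_eq_zero.mp this with h0 | h1
    · simp [h0]
    · simp [sub_eq_zero.mp h1]
  refine ⟨(Finset.univ.filter fun i => μ i = 1).card, ?_⟩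
  rw [← h 0, Finset.card_filter, Nat.cast_sum]
  refine Finset.sum_congr rfl fun i _ => ?_
  conv_lhs => rw [h01 i]
  split_ifs <;> simp

end PowerSums

section TraceFunctions

variable {K : Type*} [Field K]

/-- A linear functional on matrices vanishing on commutators is a multiple of the trace. -/
lemma Matrix.exists_eq_mul_trace {d : ℕ} [NeZero d] (t : Matrix (Fin d) (Fin d) K →ₗ[K] K)
    (h : ∀ A B, t (A * B) = t (B * A)) (A : Matrix (Fin d) (Fin d) K) :
    t A = t (Matrix.single 0 0 1) * A.trace := by
  have hs : ∀ i j (a : K), t (Matrix.single i j a) =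
      t (Matrix.single 0 0 1) * (Matrix.single i j a).trace := fun i j a => by
    have h1 : Matrix.single i j a =
        Matrix.single i (0 : Fin d) a * Matrix.single (0 : Fin d) j 1 := by
      rw [Matrix.single_mul_single_same, mul_one]
    rw [h1, h]
    by_cases hij : j = i
    · subst hij
      rw [Matrix.single_mul_single_same, Matrix.single_mul_single_same, one_mul, mul_one,
        Matrix.trace_single_eq_same, mul_comm, ← smul_eq_mul a, ← map_smul, Matrix.smul_single,
        smul_eq_mul, mul_one]
    · rw [Matrix.single_mul_single_of_ne _ _ _ _ hij, Matrix.single_mul_single_same,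
        Matrix.trace_single_eq_of_ne _ _ _ (Ne.symm hij), mul_zero, map_zero]
  induction A using Matrix.induction_on' with
  | h_zero => simp
  | h_add p q hp hq => rw [map_add, hp, hq, Matrix.trace_add, mul_add]
  | h_std_basis i j x => exact hs i j x

/-- The block diagonal representation with `c i` copies of the `i`-th block. -/
lemma exists_algHom_matrix_of_mul_trace {n m : ℕ} (d c : Fin n → ℕ) (hcd : ∑ i, c i * d i = m) :
    ∃ ρ : (∀ i, Matrix (Fin (d i)) (Fin (d i)) K) →ₐ[K] Matrix (Fin m) (Fin m) K,
      ∀ M, (ρ M).trace = ∑ i, (c i : K) * (M i).trace := by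
  have hcard : Fintype.card (Σ p : (Σ i, Fin (c i)), Fin (d p.1)) = Fintype.card (Fin m) := by
    simp [Fintype.card_sigma, Fintype.sum_sigma, ← hcd]
  let e := Fintype.equivOfCardEq hcard
  let β : (∀ i, Matrix (Fin (d i)) (Fin (d i)) K) →ₐ[K]
      Matrix (Σ p : (Σ i, Fin (c i)), Fin (d p.1)) (Σ p : (Σ i, Fin (c i)), Fin (d p.1)) K :=
    AlgHom.ofLinearMap
      { toFun := fun M => Matrix.blockDiagonal' fun p : (Σ i, Fin (c i)) => M p.1
        map_add' := fun M N => Matrix.blockDiagonal'_add _ _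
        map_smul' := fun a M => Matrix.blockDiagonal'_smul a _ }
      Matrix.blockDiagonal'_one
      (fun M N => Matrix.blockDiagonal'_mul (fun p : (Σ i, Fin (c i)) => M p.1) fun p => N p.1)
  refine ⟨(Matrix.reindexAlgEquiv K K e).toAlgHom.comp β, fun M => ?_⟩
  have h1 : (((Matrix.reindexAlgEquiv K K e).toAlgHom.comp β) M).trace = (β M).trace := by
    change ((β M).submatrix e.symm e.symm).trace = _
    exact Equiv.sum_comp e.symm (fun i => β M i i)
  rw [h1]
  change (Matrix.blockDiagonal' fun p : (Σ i, Fin (c i)) => M p.1).trace = _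
  rw [Matrix.trace_blockDiagonal', Fintype.sum_sigma]
  refine Finset.sum_congr rfl fun i _ => ?_
  change ∑ _ : Fin (c i), (M i).trace = _
  simp

variable [IsAlgClosed K] [CharZero K]

lemma exists_algHom_matrix_of_nondegenerate {B : Type*} [Ring B] [Algebra K B]
    [FiniteDimensional K B] {m : ℕ} (t : B →ₗ[K] K) (hcomm : ∀ a b, t (a * b) = t (b * a))
    (hnd : ∀ a, (∀ b, t (a * b) = 0) → a = 0)
    (hpow : ∀ a, ∃ μ : Fin m → K, ∀ j : ℕ, t (a ^ j) = ∑ i, μ i ^ j) :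
    ∃ ρ : B →ₐ[K] Matrix (Fin m) (Fin m) K, ∀ a, (ρ a).trace = t a := by
  have hnil : ∀ a, IsNilpotent a → t a = 0 := fun a ⟨J, hJ⟩ => by
    obtain ⟨μ, hμ⟩ := hpow a
    have h0 := eq_zero_of_sum_pow_eventually_zero μ J fun j hj => by
      rw [← hμ, pow_eq_zero_of_le hj hJ, map_zero]
    rw [← pow_one a, hμ]
    simp [h0]
  have hidem : ∀ a, a * a = a → ∃ n : ℕ, t a = n := fun a ha => by
    obtain ⟨μ, hμ⟩ := hpow a
    refine exists_nat_eq_of_sum_pow_const μ (t a) fun j => ?_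
    rw [← hμ, IsIdempotentElem.pow_succ_eq j ha]
  have : IsArtinianRing B := IsArtinianRing.of_finite K B
  have hss : IsSemisimpleRing B := by
    rw [IsArtinianRing.isSemisimpleRing_iff_jacobson, eq_bot_iff]
    intro a ha
    refine (Submodule.mem_bot _).mpr (hnd a fun b => hnil _ ?_)
    obtain ⟨J, hJ⟩ := IsArtinianRing.isNilpotent_jacobson_bot (R := B)
    have hab : a * b ∈ Ideal.jacobson (⊥ : Ideal B) := by
      rw [Ideal.jacobson_bot]
      exact Ideal.mul_mem_right _ _ ha
    have := Ideal.pow_mem_pow hab J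
    rw [hJ] at this
    exact ⟨J, this⟩
  obtain ⟨n, d, hd, ⟨e⟩⟩ := IsSemisimpleRing.exists_algEquiv_pi_matrix_of_isAlgClosed K B
  let s : ∀ i, Matrix (Fin (d i)) (Fin (d i)) K →ₗ[K] K := fun i =>
    t ∘ₗ e.symm.toLinearMap ∘ₗ LinearMap.single K (fun i => Matrix (Fin (d i)) (Fin (d i)) K) i
  have hs : ∀ i A, s i A = t (e.symm (Pi.single i A)) := fun i A => rfl
  have hscomm : ∀ i A C, s i (A * C) = s i (C * A) := fun i A C => by
    rw [hs, hs, Pi.single_mul, Pi.single_mul, map_mul e.symm, map_mul e.symm, hcomm]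
  have hnat : ∀ i, ∃ c : ℕ, s i (Matrix.single 0 0 1) = c := fun i => by
    rw [hs]
    refine hidem _ ?_
    rw [← map_mul, ← Pi.single_mul, Matrix.single_mul_single_same, one_mul]
  choose c hc using hnat
  have ht : ∀ M, t (e.symm M) = ∑ i, (c i : K) * (M i).trace := fun M => by
    conv_lhs => rw [← Finset.univ_sum_single M]
    rw [map_sum, map_sum]
    refine Finset.sum_congr rfl fun i _ => ?_
    rw [← hs, Matrix.exists_eq_mul_trace (s i) (hscomm i), hc]
  have hcd : ∑ i, c i * d i = m := by
    obtain ⟨μ, hμ⟩ := hpow 1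
    have h1 := hμ 0
    rw [pow_zero, ← map_one e.symm, ht] at h1
    simp only [Pi.one_apply, Matrix.trace_one, Fintype.card_fin, pow_zero, Finset.sum_const,
      Finset.card_univ, nsmul_eq_mul, mul_one] at h1
    exact_mod_cast h1
  obtain ⟨ρ, hρ⟩ := exists_algHom_matrix_of_mul_trace (K := K) d c hcd
  refine ⟨ρ.comp e.toAlgHom, fun a => ?_⟩
  change (ρ (e a)).trace = t a
  rw [hρ, ← ht, e.symm_apply_apply]

/-- A central functional `t` on an algebra whose Gram matrix has finite rank, and such that the
sequences `t (a ^ j)` are power sums of `m` scalars, is the trace of an `m`-dimensional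
representation. -/
theorem exists_algHom_matrix_trace_eq {F : Type*} [Ring F] [Algebra K F] {m n : ℕ}
    (t : F →ₗ[K] K) (hcomm : ∀ a b, t (a * b) = t (b * a))
    (hminor : ∀ a b : Fin (n + 1) → F, (Matrix.of fun i j => t (a i * b j)).det = 0)
    (hpow : ∀ a, ∃ μ : Fin m → K, ∀ j : ℕ, t (a ^ j) = ∑ i, μ i ^ j) :
    ∃ ρ : F →ₐ[K] Matrix (Fin m) (Fin m) K, ∀ a, (ρ a).trace = t a := by
  let I : Ideal F :=
    { carrier := {a | ∀ b, t (a * b) = 0}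
      add_mem' := fun {x y} hx hy b => by rw [add_mul, map_add, hx, hy, add_zero]
      zero_mem' := fun b => by rw [zero_mul, map_zero]
      smul_mem' := fun c x hx b => by
        rw [smul_eq_mul, mul_assoc, hcomm, mul_assoc]
        exact hx _ }
  have hI : I.IsTwoSided := ⟨fun {a} c ha b => by rw [mul_assoc]; exact ha _⟩
  let G : F →ₗ[K] (F → K) :=
    { toFun := fun a b => t (a * b)
      map_add' := fun x y => by ext b; simp [add_mul]
      map_smul' := fun c x => by ext b; simp }
  have hGfin : FiniteDimensional K (LinearMap.range G) := by
    have := (span_rows_finite_of_minors_eq_zero (fun a b => t (a * b)) n hminor).1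
    refine Submodule.finiteDimensional_of_le
      (S₂ := Submodule.span K (Set.range fun a b => t (a * b))) ?_
    rintro _ ⟨a, rfl⟩
    exact Submodule.subset_span ⟨a, rfl⟩
  let Gq : (F ⧸ I) →ₗ[K] (F → K) :=
    { toFun := Quotient.lift (fun a => G a) (fun a b hab => by
        have hmem : a - b ∈ I := (Submodule.quotientRel_def I).mp hab
        ext c
        exact sub_eq_zero.mp (by simpa [G, sub_mul] using hmem c))
      map_add' := by
        rintro ⟨x⟩ ⟨y⟩
        exact G.map_add x y
      map_smul' := by
        rintro c ⟨x⟩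
        exact G.map_smul c x }
  have hGq : ∀ a, Gq (Ideal.Quotient.mk I a) = G a := fun a => rfl
  have hinj : Function.Injective Gq := by
    rw [injective_iff_map_eq_zero]
    intro x hx
    obtain ⟨a, rfl⟩ := Ideal.Quotient.mk_surjective x
    exact Ideal.Quotient.eq_zero_iff_mem.mpr fun b => congrFun hx b
  have hfd : FiniteDimensional K (F ⧸ I) := by
    have hle : LinearMap.range Gq ≤ LinearMap.range G := by
      rintro _ ⟨x, rfl⟩
      obtain ⟨a, rfl⟩ := Ideal.Quotient.mk_surjective x
      exact ⟨a, rfl⟩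
    have := Submodule.finiteDimensional_of_le hle
    exact Module.Finite.equiv (LinearEquiv.ofInjective Gq hinj).symm
  let tq : (F ⧸ I) →ₗ[K] K := LinearMap.proj (1 : F) ∘ₗ Gq
  have htq : ∀ a, tq (Ideal.Quotient.mk I a) = t a := fun a => by
    change t (a * 1) = t a
    rw [mul_one]
  obtain ⟨ρ, hρ⟩ := exists_algHom_matrix_of_nondegenerate (m := m) tq
    (fun x y => by
      obtain ⟨a, rfl⟩ := Ideal.Quotient.mk_surjective x
      obtain ⟨b, rfl⟩ := Ideal.Quotient.mk_surjective y
      rw [← map_mul, ← map_mul, htq, htq, hcomm])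
    (fun x hx => by
      obtain ⟨a, rfl⟩ := Ideal.Quotient.mk_surjective x
      refine Ideal.Quotient.eq_zero_iff_mem.mpr fun b => ?_
      rw [← htq, map_mul]
      exact hx _)
    (fun x => by
      obtain ⟨a, rfl⟩ := Ideal.Quotient.mk_surjective x
      obtain ⟨μ, hμ⟩ := hpow a
      exact ⟨μ, fun j => by rw [← map_pow, htq, hμ]⟩)
  exact ⟨ρ.comp (Ideal.Quotient.mkₐ K I), fun a => (hρ _).trans (htq a)⟩

end TraceFunctions

section Specialization

/-- Points with values in an algebraically closed field extend along integral extensions. -/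
lemma exists_algHom_extension_of_isIntegral {K T S : Type*} [Field K] [IsAlgClosed K] [CommRing T]
    [CommRing S] [Algebra K T] [Algebra K S] [Algebra T S] [IsScalarTower K T S]
    [Algebra.IsIntegral T S] (hinj : Function.Injective (algebraMap T S)) (φ : T →ₐ[K] K) :
    ∃ φ' : S →ₐ[K] K, ∀ x, φ' (algebraMap T S x) = φ x := by
  have hsurj : Function.Surjective φ := fun c => ⟨algebraMap K T c, φ.commutes c⟩
  have hmax : (RingHom.ker φ).IsMaximal := RingHom.ker_isMaximal_of_surjective φ hsurj
  obtain ⟨Q, hQ, hcomap⟩ := Ideal.exists_ideal_over_maximal_of_isIntegral (S := S) (RingHom.ker φ)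
    (by rw [(RingHom.injective_iff_ker_eq_bot _).mp hinj]; exact bot_le)
  have hφ : ∀ x, Ideal.Quotient.mk Q (algebraMap T S x) = algebraMap K (S ⧸ Q) (φ x) := fun x => by
    have hmem : x - algebraMap K T (φ x) ∈ Q.comap (algebraMap T S) := by
      rw [hcomap, RingHom.mem_ker, map_sub, AlgHom.commutes, Algebra.algebraMap_self_apply,
        sub_self]
    rw [Ideal.mem_comap, map_sub, ← IsScalarTower.algebraMap_apply] at hmem
    exact Ideal.Quotient.eq.mpr hmem
  have hint : Algebra.IsIntegral K (S ⧸ Q) := ⟨fun y => by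
    obtain ⟨x, rfl⟩ := Ideal.Quotient.mk_surjective y
    refine (Algebra.IsIntegral.isIntegral (R := T) x).map_of_comp_eq (φ : T →+* K)
      (Ideal.Quotient.mk Q) (RingHom.ext fun x => ?_)
    exact (hφ x).symm⟩
  let e : K ≃ₐ[K] (S ⧸ Q) := AlgEquiv.ofBijective (Algebra.ofId K (S ⧸ Q))
    IsAlgClosed.algebraMap_bijective_of_isIntegral
  refine ⟨e.symm.toAlgHom.comp (Ideal.Quotient.mkₐ K Q), fun x => ?_⟩
  change e.symm (Ideal.Quotient.mk Q (algebraMap T S x)) = φ x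
  rw [hφ, AlgEquiv.symm_apply_eq]
  rfl

variable {K L : Type*} [Field K] [CharZero K] [Field L] [IsAlgClosed L] [Algebra K L] {m r : ℕ}

lemma isIntegral_trace_word (T : Subalgebra K L) (X : Fin r → Matrix (Fin m) (Fin m) L)
    (h : ∀ w : List (Fin r), w ≠ [] → w.length ≤ m ^ 2 → ((w.map X).prod).trace ∈ T)
    (w : List (Fin r)) (hw : w ≠ []) : IsIntegral T ((w.map X).prod).trace := by
  have hmem : ((w.map X).prod).trace ∈
      (integralClosure (Subring.closure (T : Set L)) L).toSubring := by
    rw [← iInf_valuationSubring_superset, Subring.mem_iInf]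
    rintro ⟨V, hV⟩
    exact V.trace_word_mem (fun x => hV (T.algebraMap_mem x)) X
      (fun u hu hlen => hV (h u hu hlen)) w hw
  have hle : Subring.closure (T : Set L) ≤ T.toSubring := Subring.closure_le.mpr fun _ hx => hx
  exact IsIntegral.map_of_comp_eq (Subring.inclusion hle) (RingHom.id L) (RingHom.ext fun _ => rfl)
    (show IsIntegral (Subring.closure (T : Set L)) ((w.map X).prod).trace from hmem)

lemma Matrix.exists_eigenvalues_mem (E : Subalgebra K L) (hE : ∀ x : L, IsIntegral E x → x ∈ E)
    (A : Matrix (Fin m) (Fin m) L) (h : ∀ j, (A ^ j).trace ∈ E) :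
    ∃ μ : Fin m → E, ∀ j : ℕ, (A ^ j).trace = ∑ i, (μ i : L) ^ j := by
  obtain ⟨μ, hμ, htr⟩ := A.exists_eigenvalues
  have hlifts : A.charpoly ∈ Polynomial.lifts (algebraMap E L) := by
    rw [Polynomial.lifts_iff_coeff_lifts]
    intro k
    have hk : A.charpoly.coeff k ∈ E := by
      rcases lt_trichotomy k m with hk | hk | hk
      · exact Matrix.charpoly_coeff_mem E.toNonUnitalSubalgebra A (fun j _ => h j) hk
      · have := A.charpoly_monic.coeff_natDegree
        rw [A.charpoly_natDegree_eq_dim, Fintype.card_fin] at this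
        rw [hk, this]
        exact one_mem E
      · rw [Polynomial.coeff_eq_zero_of_natDegree_lt
          (by rwa [A.charpoly_natDegree_eq_dim, Fintype.card_fin])]
        exact zero_mem E
    exact ⟨⟨_, hk⟩, rfl⟩
  obtain ⟨q, hq, -, hmonic⟩ := Polynomial.lifts_and_natDegree_eq_and_monic hlifts A.charpoly_monic
  have hmem : ∀ i, μ i ∈ E := fun i => hE _ ⟨q, hmonic, by
    rw [← Polynomial.eval_map, hq, hμ, Polynomial.eval_prod]
    exact Finset.prod_eq_zero (Finset.mem_univ i) (by simp)⟩
  exact ⟨fun i => ⟨μ i, hmem i⟩, htr⟩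

/-- A `K`-point of an integrally closed ring containing all traces of words in `X` is realized by
a tuple of matrices over `K`. -/
theorem exists_matrices_trace_word_eq [IsAlgClosed K] (E : Subalgebra K L)
    (hE : ∀ x : L, IsIntegral E x → x ∈ E) (φ : E →ₐ[K] K)
    (X : Fin r → Matrix (Fin m) (Fin m) L)
    (h : ∀ w : List (Fin r), w ≠ [] → ((w.map X).prod).trace ∈ E) :
    ∃ A : Fin r → Matrix (Fin m) (Fin m) K, ∀ (w : List (Fin r)) (hw : w ≠ []),
      ((w.map A).prod).trace = φ ⟨((w.map X).prod).trace, h w hw⟩ := by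
  let ρ := MonoidAlgebra.lift K (Matrix (Fin m) (Fin m) L) (FreeMonoid (Fin r)) (FreeMonoid.lift X)
  have hword : ∀ w : FreeMonoid (Fin r), (FreeMonoid.lift X w).trace ∈ E := fun w => by
    rw [FreeMonoid.lift_apply]
    by_cases hw : w.toList = []
    · rw [hw, List.map_nil, List.prod_nil, trace_one]
      exact natCast_mem E _
    · exact h _ hw
  have hρ : ∀ a, (ρ a).trace ∈ E := fun a => by
    induction a using MonoidAlgebra.induction_linear with
    | zero => rw [map_zero, trace_zero]; exact zero_mem E
    | add a b ha hb => rw [map_add, trace_add]; exact add_mem ha hb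
    | single w c =>
      rw [MonoidAlgebra.lift_single, trace_smul]
      exact E.smul_mem (hword w) c
  let t : MonoidAlgebra K (FreeMonoid (Fin r)) →ₗ[K] K :=
    φ.toLinearMap ∘ₗ
      LinearMap.codRestrict E.toSubmodule (Matrix.traceLinearMap (Fin m) K L ∘ₗ ρ.toLinearMap) hρ
  have ht : ∀ a, t a = φ ⟨(ρ a).trace, hρ a⟩ := fun a => rfl
  obtain ⟨σ, hσ⟩ := exists_algHom_matrix_trace_eq (m := m) (n := m ^ 2) t
    (fun a b => by
      rw [ht, ht]
      refine congrArg φ (Subtype.ext ?_)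
      simp only [map_mul]
      exact trace_mul_comm _ _)
    (fun a b => by
      let G : Matrix (Fin (m ^ 2 + 1)) (Fin (m ^ 2 + 1)) E :=
        Matrix.of fun i j => ⟨(ρ (a i * b j)).trace, hρ _⟩
      have hG : G.det = 0 := by
        refine Subtype.ext ((E.val.toRingHom.map_det G).trans ?_)
        have h1 := det_trace_mul_eq_zero (fun i => ρ (a i)) (fun j => ρ (b j))
        simp_rw [← map_mul] at h1
        exact h1
      have h2 := φ.toRingHom.map_det G
      rw [hG, map_zero] at h2
      exact h2.symm)
    (fun a => by
      obtain ⟨μ, hμ⟩ := Matrix.exists_eigenvalues_mem E hE (ρ a) fun j => by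
        rw [← map_pow]
        exact hρ _
      refine ⟨fun i => φ (μ i), fun j => ?_⟩
      simp_rw [ht, ← map_pow φ, ← map_sum φ]
      refine congrArg φ (Subtype.ext ?_)
      simp only [map_pow, hμ]
      simp)
  let A : Fin r → Matrix (Fin m) (Fin m) K := fun i =>
    σ (MonoidAlgebra.of K _ (FreeMonoid.of i))
  refine ⟨A, fun w hw => ?_⟩
  have hA : (σ : MonoidAlgebra K (FreeMonoid (Fin r)) →* Matrix (Fin m) (Fin m) K).comp
      (MonoidAlgebra.of K (FreeMonoid (Fin r))) = FreeMonoid.lift A :=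
    FreeMonoid.hom_eq fun i => by simp [A]
  have hAw : (w.map A).prod = σ (MonoidAlgebra.of K _ (FreeMonoid.ofList w)) :=
    (FreeMonoid.lift_apply A (FreeMonoid.ofList w)).symm.trans
      (DFunLike.congr_fun hA (FreeMonoid.ofList w)).symm
  rw [hAw, hσ, ht]
  refine congrArg φ (Subtype.ext ?_)
  simp only [ρ, MonoidAlgebra.lift_of, FreeMonoid.lift_apply, FreeMonoid.toList_ofList]

/-- A `K`-point of the algebra generated by the traces of words of length at most `m ^ 2` is
realized by a tuple of matrices over `K`. -/
theorem exists_matrices_of_algHom [IsAlgClosed K] (T : Subalgebra K L) (φ : T →ₐ[K] K)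
    (X : Fin r → Matrix (Fin m) (Fin m) L)
    (h : ∀ w : List (Fin r), w ≠ [] → w.length ≤ m ^ 2 → ((w.map X).prod).trace ∈ T) :
    ∃ A : Fin r → Matrix (Fin m) (Fin m) K, ∀ (w : List (Fin r)) (hw : w ≠ [])
      (hlen : w.length ≤ m ^ 2),
      ((w.map A).prod).trace = φ ⟨((w.map X).prod).trace, h w hw hlen⟩ := by
  obtain ⟨φ', hφ'⟩ := exists_algHom_extension_of_isIntegral (T := T) (S := integralClosure T L)
    (fun x y hxy => Subtype.ext (congrArg (fun z : integralClosure T L => (z : L)) hxy)) φ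
  obtain ⟨A, hA⟩ := exists_matrices_trace_word_eq ((integralClosure T L).restrictScalars K)
    (fun x hx => isIntegral_trans (A := integralClosure T L) x hx) φ' X
    (isIntegral_trace_word T X h)
  exact ⟨A, fun w hw hlen => (hA w hw).trans (hφ' ⟨_, h w hw hlen⟩)⟩

end Specialization

lemma map_trace_word {R S : Type*} [CommRing R] [CommRing S] {m r : ℕ} (f : R →+* S)
    (X : Fin r → Matrix (Fin m) (Fin m) R) (w : List (Fin r)) :
    f ((w.map X).prod).trace = ((w.map fun i => (X i).map f).prod).trace := by
  have h1 : (w.map fun i => (X i).map f).prod = f.mapMatrix (w.map X).prod := by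
    rw [map_list_prod, List.map_map]
    rfl
  rw [h1, AddMonoidHom.map_trace]
  rfl

/-- Mumford's theorem for matrix invariants: the image of the map `π` defined by
the trace monomials of length at most `m²` (a generating set of invariants, by
the FFT) is Zariski closed — it is the common zero set of some set `Q` of
polynomials on the ambient affine space `K^N`. -/
theorem traceMonomialMap_image_isZariskiClosed
    (K : Type*) [Field K] [IsAlgClosed K] [CharZero K] (m r : ℕ)
    (hm : 1 ≤ m) (hr : 1 ≤ r) :
    ∃ Q : Set (MvPolynomial (MatrixTraceWord r m) K),
      {x : MatrixTraceWord r m → K | ∀ q ∈ Q, MvPolynomial.eval x q = 0}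
        = Set.range (traceMonomialMap K r m) := by
  let R := MvPolynomial (Fin r × Fin m × Fin m) K
  let L := AlgebraicClosure (FractionRing R)
  let Y : Fin r → Matrix (Fin m) (Fin m) R := fun k => Matrix.of fun i j => X (k, i, j)
  let ι : R →ₐ[K] L := IsScalarTower.toAlgHom K R L
  have hι : Function.Injective ι := by
    change Function.Injective (algebraMap R L)
    rw [IsScalarTower.algebraMap_eq R (FractionRing R) L]
    exact (algebraMap (FractionRing R) L).injective.comp (IsFractionRing.injective R _)
  let ψ : MvPolynomial (MatrixTraceWord r m) K →ₐ[K] R :=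
    aeval fun w => (((w : List (Fin r)).map Y).prod).trace
  let ψL := ι.comp ψ
  refine ⟨{q | ψ q = 0}, Set.Subset.antisymm (fun x hx => ?_) ?_⟩
  · have hker : ∀ q, ψL.rangeRestrict q = 0 → aeval x q = (0 : K) := fun q hq =>
      hx q (hι (by rw [map_zero]; exact congrArg Subtype.val hq))
    let φ : ψL.range →ₐ[K] K :=
      (Ideal.Quotient.liftₐ (RingHom.ker ψL.rangeRestrict) (aeval x) hker).comp
        (Ideal.quotientKerAlgEquivOfSurjective ψL.rangeRestrict_surjective).symm.toAlgHom
    have hφ : ∀ q, φ (ψL.rangeRestrict q) = aeval x q := fun q => by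
      have hq : (Ideal.quotientKerAlgEquivOfSurjective ψL.rangeRestrict_surjective).symm
          (ψL.rangeRestrict q) = Ideal.Quotient.mk (RingHom.ker ψL.rangeRestrict) q := by
        rw [AlgEquiv.symm_apply_eq]
        rfl
      exact congrArg (Ideal.Quotient.liftₐ (RingHom.ker ψL.rangeRestrict) (aeval x) hker) hq
    have hgen : ∀ w : MatrixTraceWord r m,
        ψL (X w) = (((w : List (Fin r)).map fun k => (Y k).map ι).prod).trace := fun w => by
      change ι (aeval _ (X w)) = _
      rw [aeval_X]
      exact map_trace_word (ι : R →+* L) Y w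
    obtain ⟨A, hA⟩ := exists_matrices_of_algHom ψL.range φ (fun k => (Y k).map ι)
      fun w hw hlen => ⟨X ⟨w, hw, hlen⟩, hgen ⟨w, hw, hlen⟩⟩
    refine ⟨A, funext fun w => (hA w w.2.1 w.2.2).trans ?_⟩
    have := hφ (X w)
    rw [aeval_X] at this
    rw [← this]
    exact congrArg φ (Subtype.ext (hgen w).symm)
  · rintro _ ⟨A, rfl⟩ q hq
    let ev : R →ₐ[K] K := aeval fun p => A p.1 p.2.1 p.2.2
    have hev : ev.comp ψ = aeval (traceMonomialMap K r m A) := by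
      refine algHom_ext fun w => ?_
      rw [AlgHom.comp_apply, aeval_X, aeval_X]
      refine (map_trace_word (ev : R →+* K) Y w).trans ?_
      have hY : (fun k => (Y k).map (ev : R →+* K)) = A := by
        ext k i j
        exact aeval_X _ _
      rw [hY]
      rfl
    have := DFunLike.congr_fun hev q
    rw [AlgHom.comp_apply, show ψ q = 0 from hq, map_zero] at this
    exact this.symm
end
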